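/- arXiv:1309.5729 — 17 statements merged into one kernel-verified Lean document; each statement's English description precedes it below -/
import Mathlib

section
/- Let R be a commutative semiring, V an R-module, q a quadratic form on V, b a symmetric bilinear form on V, and S ⊆ V. If b accompanies q on S, then b accompanies q on the additive submonoid of V generated by S. -/
section Common

variable {R V ι : Type*}

/-- A symmetric bilinear form, given as a function `V → V → R`. -/
def SymmBilin [CommSemiring R] [AddCommMonoid V] [Module R V] (b : V → V → R) : Prop :=
  (∀ x y, b x y = b y x) ∧ (∀ (a : R) (x y : V), b (a • x) y = a * b x y) ∧
  (∀ x x' y : V, b (x + x') y = b x y + b x' y)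

/-- `b` accompanies `q` at the point `(x, y)`. -/
def Accomp [CommSemiring R] [AddCommMonoid V] [Module R V]
    (q : V → R) (b : V → V → R) (x y : V) : Prop :=
  q (x + y) = q x + q y + b x y

/-- `b` is a companion of `q`. -/
def IsCompanion [CommSemiring R] [AddCommMonoid V] [Module R V]
    (q : V → R) (b : V → V → R) : Prop :=
  SymmBilin b ∧ ∀ x y, Accomp q b x y

/-- `q` is a quadratic form: homogeneous of degree 2 and admits a companion. -/
def IsQuadForm [CommSemiring R] [AddCommMonoid V] [Module R V] (q : V → R) : Prop :=
  (∀ (a : R) (x : V), q (a • x) = a ^ 2 * q x) ∧ ∃ b, IsCompanion q b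

/-- `q` is a quasilinear quadratic form. -/
def IsQuasilinear [CommSemiring R] [AddCommMonoid V] [Module R V] (q : V → R) : Prop :=
  IsQuadForm q ∧ ∀ x y, q (x + y) = q x + q y

/-- `q` is a rigid quadratic form: any two companions agree. -/
def IsRigid [CommSemiring R] [AddCommMonoid V] [Module R V] (q : V → R) : Prop :=
  IsQuadForm q ∧ ∀ b₁ b₂, IsCompanion q b₁ → IsCompanion q b₂ → b₁ = b₂

/-- The set `Rig(q)` of rigid complements in `q`. -/
def RigSet [CommSemiring R] [AddCommMonoid V] [Module R V] (q : V → R) : Set (V → R) :=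
  {ρ | IsRigid ρ ∧ ∃ c, IsQuasilinear c ∧ ∀ x, q x = c x + ρ x}

/-- The set `C(q)(u,v)` of values `b u v` over symmetric bilinear forms `b` accompanying
`q` on `Ru × Rv`. -/
def companionSet [CommSemiring R] [AddCommMonoid V] [Module R V]
    (q : V → R) (u v : V) : Set R :=
  {β | ∃ b : V → V → R, SymmBilin b ∧ (∀ a c : R, Accomp q b (a • u) (c • v)) ∧ b u v = β}

/-- The minimal (pre)ordering of a semiring: `x ≤ y` iff `x + z = y` for some `z`. -/
def mle [CommSemiring R] (x y : R) : Prop := ∃ z, x + z = y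

/-- `R` is an upper bound semiring: the minimal ordering is antisymmetric. -/
def IsUB (R : Type*) [CommSemiring R] : Prop :=
  ∀ x y : R, mle x y → mle y x → x = y

/-- `R` is supertropical: with `e = 1 + 1`, `e + e = e`, and for all `x y`,
if `e*x ≠ e*y` then `x + y ∈ {x, y}`, and if `e*x = e*y` then `x + y = e*y`. -/
def IsSupertropical (R : Type*) [CommSemiring R] : Prop :=
  ((1 : R) + 1) + ((1 : R) + 1) = (1 : R) + 1 ∧
  (∀ x y : R, ((1 : R) + 1) * x ≠ ((1 : R) + 1) * y → x + y = x ∨ x + y = y) ∧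
  (∀ x y : R, ((1 : R) + 1) * x = ((1 : R) + 1) * y → x + y = ((1 : R) + 1) * y)

/-- The ghost ideal `eR` of a semiring, where `e = 1 + 1`. -/
def ghost (R : Type*) [CommSemiring R] : Set R :=
  Set.range fun r : R => ((1 : R) + 1) * r

end Common

/-- If a symmetric bilinear form `b` accompanies a quadratic form `q` on
`S ⊆ V`, then it accompanies `q` on the additive submonoid generated by `S`. -/
theorem stmt_2 {R V : Type*} [CommSemiring R] [AddCommMonoid V] [Module R V]
    (q : V → R) (hq : IsQuadForm q) (b : V → V → R) (hb : SymmBilin b)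
    (S : Set V) (hS : ∀ x ∈ S, ∀ y ∈ S, Accomp q b x y) :
    ∀ x ∈ AddSubmonoid.closure S, ∀ y ∈ AddSubmonoid.closure S, Accomp q b x y := by
  obtain ⟨hh, b₀, ⟨hs₀, -, ha₀⟩, hc⟩ := hq
  obtain ⟨hsym, hsmul, hadd⟩ := hb
  have q0 : q 0 = 0 := by simpa using hh 0 0
  have b0 : ∀ x, b x 0 = 0 := fun x => by
    rw [hsym]; simpa using hsmul 0 0 x
  have sym : ∀ x y, Accomp q b x y → Accomp q b y x := fun x y h => by
    unfold Accomp at *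
    rw [add_comm y x, h, hsym y x, add_comm (q x)]
  have zero : ∀ x, Accomp q b x 0 := fun x => by simp [Accomp, q0, b0]
  have add : ∀ x y z, Accomp q b x y → Accomp q b x z → Accomp q b x (y + z) := by
    intro x y z h1 h2
    unfold Accomp at *
    have e1 := hc x y
    have e2 := hc x z
    have e3 := hc y z
    have e4 := hc x (y + z)
    have e5 : b₀ x (y + z) = b₀ x y + b₀ x z := by
      rw [hs₀, ha₀, hs₀ y, hs₀ z]
    have e6 : b x (y + z) = b x y + b x z := by
      rw [hsym, hadd, hsym y, hsym z]
    calc q (x + (y + z)) = (q x + q y + b₀ x y) + q z + b₀ x z + b₀ y z := by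
          rw [e4, e3, e5]; ring
      _ = (q x + q z + b₀ x z) + q y + b x y + b₀ y z := by
          rw [← e1, h1]; ring
      _ = q x + (q y + q z + b₀ y z) + (b x y + b x z) := by
          rw [← e2, h2]; ring
      _ = _ := by rw [← e3, e6]
  have step : ∀ x, (∀ y ∈ S, Accomp q b x y) →
      ∀ y ∈ AddSubmonoid.closure S, Accomp q b x y := by
    intro x hx y hy
    induction hy using AddSubmonoid.closure_induction with
    | mem y hy => exact hx y hy
    | zero => exact zero x
    | add y z _ _ h1 h2 => exact add x y z h1 h2
  intro x hx
  exact step x fun y hy => sym _ _ (step y (hS y hy) x hx)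
end

section
/- Let R be a commutative semiring, V an R-module, q a quadratic form on V, and (ε_i)_{i∈I} a family of elements generating V as an R-module. If a symmetric bilinear form b accompanies q on the set S = ⋃_{i∈I} Rε_i, then b is a companion of q, i.e. q(x+y) = q(x) + q(y) + b(x,y) for all x, y ∈ V. -/
theorem accomp_add_right_aux {R V : Type*} [CommSemiring R] [AddCommMonoid V] [Module R V]
    (q : V → R) (b₀ b : V → V → R) (h₀ : IsCompanion q b₀) (hb : SymmBilin b) (x y z : V)
    (h1 : Accomp q b x y) (h2 : Accomp q b x z) : Accomp q b x (y + z) := by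
  obtain ⟨⟨s0, -, a0⟩, c0⟩ := h₀
  obtain ⟨s, -, a⟩ := hb
  unfold Accomp at *
  have e1 := (c0 x y).symm.trans h1
  have e2 := (c0 x z).symm.trans h2
  have r0 : b₀ x (y + z) = b₀ x y + b₀ x z := by rw [s0, a0, s0 y, s0 z]
  have r : b x (y + z) = b x y + b x z := by rw [s, a, s y, s z]
  rw [c0 x (y + z), c0 y z, r0, r]
  calc q x + (q y + q z + b₀ y z) + (b₀ x y + b₀ x z)
      = (q x + q y + b₀ x y) + (q z + b₀ y z + b₀ x z) := by ring
    _ = (q x + q y + b x y) + (q z + b₀ y z + b₀ x z) := by rw [e1]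
    _ = (q x + q z + b₀ x z) + (q y + b₀ y z + b x y) := by ring
    _ = (q x + q z + b x z) + (q y + b₀ y z + b x y) := by rw [e2]
    _ = _ := by ring

/-- If `(ε_i)` generates `V` and the symmetric bilinear form `b`
accompanies `q` on `⋃_i Rε_i`, then `b` is a companion of `q`. -/
theorem stmt_3 {R V ι : Type*} [CommSemiring R] [AddCommMonoid V] [Module R V]
    (q : V → R) (hq : IsQuadForm q) (ε : ι → V)
    (hgen : Submodule.span R (Set.range ε) = ⊤)
    (b : V → V → R) (hb : SymmBilin b)
    (hacc : ∀ x ∈ ⋃ i : ι, Set.range fun a : R => a • ε i,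
            ∀ y ∈ ⋃ i : ι, Set.range fun a : R => a • ε i, Accomp q b x y) :
    ∀ x y : V, Accomp q b x y := by
  obtain ⟨hq2, b₀, h₀⟩ := hq
  have hzero : ∀ x, Accomp q b x 0 := by
    intro x
    have q0 : q 0 = 0 := by simpa using hq2 0 0
    have b0 : b x 0 = 0 := by
      rw [hb.1]
      simpa using hb.2.1 0 0 x
    unfold Accomp
    simp [q0, b0]
  have hsymm : ∀ x y, Accomp q b x y → Accomp q b y x := by
    intro x y h
    unfold Accomp at *
    rw [add_comm y x, h, hb.1 x y, add_comm (q x)]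
  have key : ∀ x, (∀ y ∈ ⋃ i : ι, Set.range fun a : R => a • ε i, Accomp q b x y) →
      ∀ y, Accomp q b x y := by
    intro x hx y
    have hy : y ∈ Submodule.span R (Set.range ε) := hgen ▸ Submodule.mem_top
    induction hy using Submodule.closure_induction with
    | zero => exact hzero x
    | add y z _ _ h1 h2 => exact accomp_add_right_aux q b₀ b h₀ hb x y z h1 h2
    | smul_mem r y h =>
      obtain ⟨i, rfl⟩ := h
      exact hx _ (Set.mem_iUnion.2 ⟨i, r, rfl⟩)
  intro x
  exact key x fun y hy => hsymm _ _ (key y (hacc y hy) x)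
end

section
/- Let R be a commutative semiring, V an R-module, and q a quadratic form on V. Let W be the R-submodule of V generated by the set {x ∈ V | q(x) = 0}. Then q is rigid on W, i.e. any two companions of q agree at every point of W × W. -/
/-- Any quadratic form `q` is rigid on the submodule generated by its
zero set: any two companions agree at every point of `W × W`. -/
theorem stmt_4 {R V : Type*} [CommSemiring R] [AddCommMonoid V] [Module R V]
    (q : V → R) (hq : IsQuadForm q) :
    ∀ x ∈ Submodule.span R {v : V | q v = 0},
    ∀ y ∈ Submodule.span R {v : V | q v = 0},
    ∀ b₁ b₂ : V → V → R, IsCompanion q b₁ → IsCompanion q b₂ → b₁ x y = b₂ x y := by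
  intro x hx y hy b₁ b₂ h₁ h₂
  obtain ⟨⟨s₁, m₁, a₁⟩, c₁⟩ := h₁
  obtain ⟨⟨s₂, m₂, a₂⟩, c₂⟩ := h₂
  have z₁ : ∀ v, b₁ 0 v = 0 := fun v => by simpa using m₁ 0 0 v
  have z₂ : ∀ v, b₂ 0 v = 0 := fun v => by simpa using m₂ 0 0 v
  induction hx using Submodule.span_induction with
  | mem x hx =>
    rw [s₁ x y, s₂ x y]
    induction hy using Submodule.span_induction with
    | mem y hy =>
      have e₁ := c₁ y x
      have e₂ := c₂ y x
      simp only [Set.mem_setOf_eq] at hx hy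
      simp only [Accomp, hx, hy, zero_add] at e₁ e₂
      rw [← e₁, ← e₂]
    | zero => rw [z₁, z₂]
    | add u v _ _ hu hv => rw [a₁, a₂, hu, hv]
    | smul a u _ hu => rw [m₁, m₂, hu]
  | zero => rw [z₁, z₂]
  | add u v _ _ hu hv => rw [a₁, a₂, hu, hv]
  | smul a u _ hu => rw [m₁, m₂, hu]
end

section
/- Let R be a commutative semiring satisfying: (i) a + a = 0 implies a = 0 for all a ∈ R, and (ii) (a+b)^2 = a^2 + b^2 for all a, b ∈ R. Let V be a free R-module with basis (ε_i)_{i∈I} and q a quadratic form on V. Then q is rigid if and only if q(ε_i) = 0 for every i ∈ I. -/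
theorem aux_comp {R V ι : Type*} [CommSemiring R] [AddCommMonoid V] [Module R V]
    (q : V → R) (b : V → V → R) (hq : ∀ (a : R) (x : V), q (a • x) = a ^ 2 * q x)
    (hb : IsCompanion q b) (f : V →ₗ[R] R) (p : V →ₗ[R] V) (e : V)
    (hx : ∀ x, x = f x • e + p x) (α : R)
    (hα : ∀ s t : R, (s + t) ^ 2 * q e = s ^ 2 * q e + t ^ 2 * q e + α * (s * t)) :
    IsCompanion q (fun x y => α * (f x * f y) + f x * b e (p y) + f y * b e (p x)
      + b (p x) (p y)) := by
  obtain ⟨⟨hs, hm, ha⟩, hc⟩ := hb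
  have hm' : ∀ (a : R) (x y : V), b x (a • y) = a * b x y := fun a x y => by
    rw [hs, hm, hs]
  have ha' : ∀ x y y' : V, b x (y + y') = b x y + b x y' := fun x y y' => by
    rw [hs, ha, hs y, hs y']
  have hqx : ∀ x, q x = f x ^ 2 * q e + q (p x) + f x * b e (p x) := fun x => by
    conv_lhs => rw [hx x]
    rw [hc, hq, hm]
  refine ⟨⟨fun x y => ?_, fun a x y => ?_, fun x x' y => ?_⟩, fun x y => ?_⟩
  · simp only [hs (p x) (p y)]; ring
  · simp only [map_smul, smul_eq_mul, hm, hm']; ring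
  · simp only [map_add, ha, ha']; ring
  · unfold Accomp
    rw [hqx (x + y), hqx x, hqx y]
    have h3 : q (p x + p y) = q (p x) + q (p y) + b (p x) (p y) := hc _ _
    simp only [map_add, hα, h3, ha']
    ring

/-- Over a semiring with `a + a = 0 → a = 0` and `(a+b)² = a² + b²`,
a quadratic form on a free module is rigid iff it vanishes on the basis. -/
theorem stmt_5 {R V ι : Type*} [CommSemiring R] [AddCommMonoid V] [Module R V]
    (h1 : ∀ a : R, a + a = 0 → a = 0)
    (h2 : ∀ a b : R, (a + b) ^ 2 = a ^ 2 + b ^ 2)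
    (ε : Module.Basis ι R V) (q : V → R) (hq : IsQuadForm q) :
    (∀ b₁ b₂ : V → V → R, IsCompanion q b₁ → IsCompanion q b₂ → b₁ = b₂) ↔
      ∀ i : ι, q (ε i) = 0 := by
  classical
  obtain ⟨hh, b, hb⟩ := hq
  constructor
  · intro H i
    let p : V →ₗ[R] V := ε.constr ℕ (fun j => if j = i then 0 else ε j)
    have hx : ∀ x, x = ε.coord i x • ε i + p x := by
      have : (LinearMap.id : V →ₗ[R] V) = (ε.coord i).smulRight (ε i) + p := by
        apply ε.ext
        intro j
        by_cases hj : j = i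
        · subst hj; simp [p, Module.Basis.constr_basis]
        · simp [p, Module.Basis.constr_basis, hj]
      intro x
      exact LinearMap.congr_fun this x
    have hp : p (ε i) = 0 := by simp [p, Module.Basis.constr_basis]
    have c0 := aux_comp (ι := ι) q b hh hb (ε.coord i) p (ε i) hx 0
      (fun s t => by rw [h2]; ring)
    have c1 := aux_comp (ι := ι) q b hh hb (ε.coord i) p (ε i) hx (q (ε i) + q (ε i))
      (fun s t => by ring)
    have h := congrFun (congrFun (H _ _ c1 c0) (ε i)) (ε i)
    have hb0 : ∀ y, b 0 y = 0 := fun y => by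
      have := hb.1.2.1 0 0 y
      simpa using this
    have hb0' : ∀ y, b y 0 = 0 := fun y => by rw [hb.1.1, hb0]
    simp [hp, hb0, hb0'] at h
    exact h1 _ h
  · intro H b₁ b₂ k₁ k₂
    have key : ∀ c : V → V → R, IsCompanion q c → ∀ i j, c (ε i) (ε j) = q (ε i + ε j) := by
      intro c hc i j
      rw [hc.2, H, H]; simp
    have toL : ∀ c : V → V → R, IsCompanion q c →
        ∃ B : V →ₗ[R] V →ₗ[R] R, ∀ x y, B x y = c x y := by
      rintro c ⟨⟨hs, hm, ha⟩, -⟩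
      exact ⟨LinearMap.mk₂ R c ha hm (fun x y y' => by rw [hs, ha, hs y, hs y'])
        (fun a x y => by rw [hs, hm, hs, smul_eq_mul]), fun x y => rfl⟩
    obtain ⟨B₁, e₁⟩ := toL _ k₁
    obtain ⟨B₂, e₂⟩ := toL _ k₂
    have : B₁ = B₂ := ε.ext fun i => ε.ext fun j => by
      rw [e₁, e₂, key _ k₁, key _ k₂]
    funext x y
    rw [← e₁, ← e₂, this]
end

section
/- Let R be a commutative semiring satisfying: (i) a + a = 0 implies a = 0 for all a ∈ R, and (ii) (a+b)^2 = a^2 + b^2 for all a, b ∈ R. Let V be a free R-module with basis (ε_i)_{i∈I}, where I carries a linear order, let q be a quadratic form on V and b a companion of q. Define, for x = Σ_i x_iε_i, q_QL(x) := Σ_i q(ε_i)·x_i^2 and ρ(x) := Σ_{i<j} b(ε_i, ε_j)·x_i·x_j. Then q_QL and ρ are quadratic forms on V, q_QL is quasilinear, ρ is rigid, and q = q_QL + ρ pointwise. -/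
/-- The quasilinear-rigid decomposition `q = q_QL + ρ` obtained from a
companion `b` of `q`: `q_QL` is quasilinear, `ρ` is rigid, and `q = q_QL + ρ`. -/
theorem stmt_6 {R V ι : Type*} [CommSemiring R] [AddCommMonoid V] [Module R V]
    [LinearOrder ι]
    (h1 : ∀ a : R, a + a = 0 → a = 0)
    (h2 : ∀ a b : R, (a + b) ^ 2 = a ^ 2 + b ^ 2)
    (ε : Module.Basis ι R V) (q : V → R) (hq : IsQuadForm q)
    (b : V → V → R) (hb : IsCompanion q b)
    (qQL : V → R) (hqQL : ∀ x, qQL x = (ε.repr x).sum fun i c => q (ε i) * c ^ 2)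
    (ρ : V → R) (hρ : ∀ x, ρ x = (ε.repr x).sum fun i c => (ε.repr x).sum fun j d =>
      if i < j then b (ε i) (ε j) * (c * d) else 0) :
    IsQuadForm qQL ∧ IsQuadForm ρ ∧ IsQuasilinear qQL ∧ IsRigid ρ ∧
      ∀ x, q x = qQL x + ρ x := by
  obtain ⟨⟨hsym, hsm, hadd⟩, hacc⟩ := hb
  have hsm' : ∀ (a : R) (x y : V), b x (a • y) = a * b x y := fun a x y => by
    rw [hsym, hsm, hsym]
  have hadd' : ∀ (x y y' : V), b x (y + y') = b x y + b x y' := fun x y y' => by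
    rw [hsym, hadd, hsym, hsym y']
  let Bb : V →ₗ[R] V →ₗ[R] R := LinearMap.mk₂ R b hadd hsm hadd' hsm'
  let B0 : V →ₗ[R] V →ₗ[R] R := ε.constr R fun i => ε.constr R fun j =>
    if i < j then b (ε i) (ε j) else 0
  let D : V →ₗ[R] V →ₗ[R] R := ε.constr R fun i => ε.constr R fun j =>
    if i = j then b (ε i) (ε j) else 0
  have hBb : Bb = B0 + B0.flip + D := by
    refine ε.ext fun i => ε.ext fun j => ?_
    simp only [Bb, B0, D, LinearMap.mk₂_apply, LinearMap.add_apply, LinearMap.flip_apply,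
      Module.Basis.constr_basis]
    rcases lt_trichotomy i j with h | h | h
    · simp [h, h.not_gt, h.ne]
    · simp [h]
    · simp [h, h.not_gt, h.ne', hsym (ε i)]
  have hρB : ∀ x, ρ x = B0 x x := by
    intro x
    rw [hρ]
    simp only [B0, Module.Basis.constr_apply, Finsupp.sum, LinearMap.sum_apply,
      LinearMap.smul_apply, smul_eq_mul, Finset.mul_sum]
    refine Finset.sum_congr rfl fun i _ => Finset.sum_congr rfl fun j _ => ?_
    split_ifs
    · ring
    · simp
  have hQadd : ∀ x y, qQL (x + y) = qQL x + qQL y := by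
    intro x y
    rw [hqQL, hqQL, hqQL, map_add]
    classical
    refine Finsupp.sum_add_index' (by simp) fun i c d => ?_
    rw [h2, mul_add]
  have hQsm : ∀ (a : R) x, qQL (a • x) = a ^ 2 * qQL x := by
    intro a x
    rw [hqQL, hqQL, map_smul, Finsupp.sum_smul_index (by simp), Finsupp.mul_sum]
    refine Finsupp.sum_congr fun i _ => ?_
    ring
  have hQq : IsQuadForm qQL := ⟨hQsm, fun _ _ => 0, ⟨by simp, by simp, by simp⟩, fun x y => by
    simp [Accomp, hQadd]⟩
  have hρq : IsQuadForm ρ := by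
    refine ⟨fun a x => ?_, fun x y => B0 x y + B0 y x, ⟨fun x y => add_comm _ _, ?_, ?_⟩, ?_⟩
    · simp [hρB]; ring
    · intro a x y; simp; ring
    · intro x x' y; simp; ring
    · intro x y; simp [Accomp, hρB]; ring
  refine ⟨hQq, hρq, ⟨hQq, hQadd⟩, ⟨hρq, ?_⟩, ?_⟩
  · have hρ0 : ∀ i, ρ (ε i) = 0 := fun i => by
      rw [hρB]; simp [B0, Module.Basis.constr_basis]
    have key : ∀ b₁, IsCompanion ρ b₁ → ∃ L : V →ₗ[R] V →ₗ[R] R, (∀ x y, L x y = b₁ x y) ∧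
        ∀ i j, L (ε i) (ε j) = ρ (ε i + ε j) := by
      rintro b₁ ⟨⟨s, m, a⟩, c⟩
      refine ⟨LinearMap.mk₂ R b₁ a m (fun x y y' => by rw [s, a, s, s y'])
        (fun r x y => by rw [s, m, s]; rfl), fun _ _ => rfl, fun i j => ?_⟩
      have := c (ε i) (ε j)
      rw [Accomp, hρ0, hρ0, zero_add, zero_add] at this
      exact this.symm
    intro b₁ b₂ k₁ k₂
    obtain ⟨L₁, e₁, f₁⟩ := key b₁ k₁
    obtain ⟨L₂, e₂, f₂⟩ := key b₂ k₂
    have : L₁ = L₂ := ε.ext fun i => ε.ext fun j => by rw [f₁, f₂]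
    funext x y
    rw [← e₁, ← e₂, this]
  · have hq0 : q 0 = 0 := by simpa using hq.1 0 0
    have main : ∀ f : ι →₀ R, q (ε.repr.symm f) = qQL (ε.repr.symm f) + ρ (ε.repr.symm f) := by
      intro f
      induction f using Finsupp.induction with
      | zero => simp [hq0, hqQL, hρB]
      | single_add a c f ha hc ih =>
        rw [map_add, Module.Basis.repr_symm_single]
        set y := ε.repr.symm f with hy
        have hya : ε.repr y a = 0 := by simpa [hy] using ha
        have hb' : b (c • ε a) y = B0 (c • ε a) y + B0 y (c • ε a) := by
          have e : b (c • ε a) y = Bb (c • ε a) y := rfl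
          have hD : D (c • ε a) y = 0 := by
            simp only [D, map_smul, LinearMap.smul_apply, Module.Basis.constr_basis]
            rw [Module.Basis.constr_apply, Finsupp.sum, Finset.sum_eq_zero, smul_zero]
            intro j _
            by_cases h : a = j
            · subst h; simp [hya]
            · simp [h]
          rw [e, hBb, LinearMap.add_apply, LinearMap.add_apply, LinearMap.add_apply,
            LinearMap.add_apply, hD, add_zero, LinearMap.flip_apply]
        have hqa : qQL (ε a) = q (ε a) := by simp [hqQL]
        have hρa : B0 (ε a) (ε a) = 0 := by simp [B0, Module.Basis.constr_basis]
        have h := hacc (c • ε a) y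
        rw [Accomp] at h
        rw [h, hb', ih, hq.1, hQadd, hQsm, hqa, hρB, hρB]
        simp only [map_add, LinearMap.add_apply, map_smul, LinearMap.smul_apply, hρa, smul_zero]
        ring
    intro x
    simpa using main (ε.repr x)
end

section
/- Let R be a commutative semiring satisfying: (i) a + a = 0 implies a = 0 for all a ∈ R, and (ii) (a+b)^2 = a^2 + b^2 for all a, b ∈ R. Let V be a free R-module with basis (ε_i)_{i∈I} and q a quadratic form on V. If q = c + ρ pointwise, with c a quasilinear quadratic form on V and ρ a rigid quadratic form on V, then c(x) = Σ_i q(ε_i)·x_i^2 for every x = Σ_i x_iε_i ∈ V; in particular the quasilinear summand c is uniquely determined by q. -/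
theorem rigid_basis_zero {R V ι : Type*} [CommSemiring R] [AddCommMonoid V] [Module R V]
    (h1 : ∀ a : R, a + a = 0 → a = 0)
    (h2 : ∀ a b : R, (a + b) ^ 2 = a ^ 2 + b ^ 2)
    (ε : Module.Basis ι R V) (ρ : V → R) (hρ : IsRigid ρ) (i : ι) : ρ (ε i) = 0 := by
  classical
  obtain ⟨⟨hh, b, ⟨hs, hm, ha⟩, hb⟩, hr⟩ := hρ
  have hm' : ∀ (a : R) (x y : V), b x (a • y) = a * b x y := fun a x y => by
    rw [hs, hm, hs]
  have ha' : ∀ x y y' : V, b x (y + y') = b x y + b x y' := fun x y y' => by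
    rw [hs, ha, hs y, hs y']
  obtain ⟨π, hπ⟩ : ∃ π : V → V, π = fun x => ε.repr.symm ((ε.repr x).erase i) := ⟨_, rfl⟩
  have πadd : ∀ x y, π (x + y) = π x + π y := fun x y => by
    simp [hπ, Finsupp.erase_add]
  have πsmul : ∀ (a : R) x, π (a • x) = a • π x := fun a x => by
    apply ε.repr.injective
    ext j
    simp only [hπ, map_smul, LinearEquiv.apply_symm_apply]
    by_cases h : j = i <;> simp [h]
  have πε : π (ε i) = 0 := by simp [hπ]
  have dec : ∀ x, x = π x + (ε.repr x i) • ε i := fun x => by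
    apply ε.repr.injective
    simp [hπ, Finsupp.erase_add_single]
  have hρx : ∀ x, ρ x = ρ (π x) + (ε.repr x i) ^ 2 * ρ (ε i) + ε.repr x i * b (π x) (ε i) :=
    fun x => by
      conv_lhs => rw [dec x]
      rw [hb, hh, hm']
  have comp : ∀ t : R, (∀ x y : R, (x + y) ^ 2 * ρ (ε i) = x ^ 2 * ρ (ε i) + y ^ 2 * ρ (ε i)
      + t * x * y) → IsCompanion ρ (fun x y => b (π x) (π y) + ε.repr x i * b (ε i) (π y)
        + ε.repr y i * b (ε i) (π x) + t * ε.repr x i * ε.repr y i) := by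
    intro t ht
    refine ⟨⟨fun x y => ?_, fun a x y => ?_, fun x x' y => ?_⟩, fun x y => ?_⟩
    · simp only [hs (π x) (π y)]
      ring
    · simp only [πsmul, hm, hm', map_smul, Finsupp.smul_apply, smul_eq_mul]
      ring
    · simp only [πadd, ha, ha', map_add, Finsupp.add_apply]
      ring
    · unfold Accomp
      rw [hρx (x + y), hρx x, hρx y, πadd, hb, map_add, Finsupp.add_apply, ht, ha]
      simp only [hs (ε i) (π x), hs (ε i) (π y)]
      ring
  have c0 := comp 0 (fun x y => by rw [h2]; ring)
  have c2 := comp (ρ (ε i) + ρ (ε i)) (fun x y => by ring)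
  have := congrFun (congrFun (hr _ _ c0 c2) (ε i)) (ε i)
  have hb0 : ∀ x, b x 0 = 0 := fun x => by simpa using hm' 0 x 0
  simp [πε, hb0] at this
  exact h1 _ this.symm

/-- Uniqueness of the quasilinear part: if `q = c + ρ` with `c` quasilinear
and `ρ` rigid, then `c(x) = Σ_i q(ε_i)·x_i²`. -/
theorem stmt_7 {R V ι : Type*} [CommSemiring R] [AddCommMonoid V] [Module R V]
    (h1 : ∀ a : R, a + a = 0 → a = 0)
    (h2 : ∀ a b : R, (a + b) ^ 2 = a ^ 2 + b ^ 2)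
    (ε : Module.Basis ι R V) (q c ρ : V → R) (hq : IsQuadForm q)
    (hc : IsQuasilinear c) (hρ : IsRigid ρ)
    (hsum : ∀ x, q x = c x + ρ x) :
    ∀ x : V, c x = (ε.repr x).sum fun i d => q (ε i) * d ^ 2 := by
  intro x
  have hz : ∀ i, c (ε i) = q (ε i) := fun i => by
    rw [hsum, rigid_basis_zero h1 h2 ε ρ hρ i, add_zero]
  have c0 : c 0 = 0 := by simpa using hc.1.1 0 0
  let f : V →+ R := { toFun := c, map_zero' := c0, map_add' := hc.2 }
  have hx : f x = f ((ε.repr x).sum fun i d => d • ε i) := by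
    congr 1
    conv_lhs => rw [← ε.linearCombination_repr x]
    rfl
  rw [map_finsuppSum] at hx
  refine hx.trans (Finsupp.sum_congr fun i _ => ?_)
  change c _ = _
  rw [hc.1.1, hz, mul_comm]
end

section
/- Let R be a commutative semiring satisfying: (i) a + a = 0 implies a = 0 for all a ∈ R, and (ii) (a+b)^2 = a^2 + b^2 for all a, b ∈ R. Let V be a free R-module with basis (ε_i)_{i∈I}, where I carries a linear order, and let q be a quadratic form on V. Call a companion b of q off-diagonal if b(ε_i, ε_i) = 0 for all i ∈ I. Then the assignment b ↦ ρ_b, where ρ_b(Σ_i x_iε_i) := Σ_{i<j} b(ε_i, ε_j)·x_i·x_j, is a bijection from the set of off-diagonal companions of q onto Rig(q); moreover b(ε_i, ε_j) = ρ_b(ε_i + ε_j) for all i ≠ j, and b is the unique companion of ρ_b. -/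
section Helpers

variable {R V ι : Type*} [CommSemiring R] [AddCommMonoid V] [Module R V]

/-- The bilinear form with given matrix. -/
noncomputable def LL (ε : Module.Basis ι R V) (m : ι → ι → R) : V →ₗ[R] V →ₗ[R] R :=
  ε.constr R (fun i => ε.constr R (fun j => m i j))

theorem LL_basis (ε : Module.Basis ι R V) (m : ι → ι → R) (i j : ι) :
    LL ε m (ε i) (ε j) = m i j := by
  simp [LL, Module.Basis.constr_basis]

theorem LL_apply (ε : Module.Basis ι R V) (m : ι → ι → R) (x y : V) :
    LL ε m x y = (ε.repr x).sum fun i c => (ε.repr y).sum fun j d => m i j * (c * d) := by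
  unfold LL
  rw [Module.Basis.constr_apply, Finsupp.sum, Finsupp.sum, LinearMap.sum_apply]
  refine Finset.sum_congr rfl fun i _ => ?_
  rw [LinearMap.smul_apply, Module.Basis.constr_apply, Finsupp.sum, Finsupp.sum, Finset.smul_sum]
  refine Finset.sum_congr rfl fun j _ => ?_
  simp only [smul_eq_mul]
  ring

theorem LL_flip (ε : Module.Basis ι R V) (m : ι → ι → R) (x y : V) :
    LL ε m y x = LL ε (fun i j => m j i) x y := by
  have : (LL ε m).flip = LL ε (fun i j => m j i) := by
    refine ε.ext fun i => ε.ext fun j => ?_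
    simp [LL_basis]
  rw [← this]; rfl

theorem LL_add (ε : Module.Basis ι R V) (m n : ι → ι → R) (x y : V) :
    LL ε (fun i j => m i j + n i j) x y = LL ε m x y + LL ε n x y := by
  have : LL ε (fun i j => m i j + n i j) = LL ε m + LL ε n := by
    refine ε.ext fun i => ε.ext fun j => ?_
    simp [LL_basis]
  rw [this]; rfl

theorem LL_symm (ε : Module.Basis ι R V) (m : ι → ι → R) (hm : ∀ i j, m i j = m j i) :
    SymmBilin (fun x y => LL ε m x y) := by
  refine ⟨fun x y => ?_, fun a x y => by simp, fun x x' y => by simp⟩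
  change LL ε m x y = LL ε m y x
  rw [LL_flip ε m x y]
  congr 3
  funext i j
  exact hm i j

theorem symm_eq (ε : Module.Basis ι R V) (b : V → V → R) (hb : SymmBilin b) :
    b = fun x y => LL ε (fun i j => b (ε i) (ε j)) x y := by
  obtain ⟨hs, hm, ha⟩ := hb
  have : LinearMap.mk₂ R b ha hm
      (fun x y z => by rw [hs, ha, hs y, hs z]) (fun a x y => by rw [hs, hm, hs y]; rfl)
      = LL ε (fun i j => b (ε i) (ε j)) := by
    refine ε.ext fun i => ε.ext fun j => ?_
    simp [LL_basis]
  rw [← this]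
  rfl

theorem LL_comp (ε : Module.Basis ι R V) (m : ι → ι → R) :
    IsCompanion (fun x => LL ε m x x) (fun x y => LL ε (fun i j => m i j + m j i) x y) := by
  refine ⟨LL_symm ε _ fun i j => add_comm _ _, fun x y => ?_⟩
  change LL ε m (x + y) (x + y) = LL ε m x x + LL ε m y y + LL ε _ x y
  rw [LL_add ε m (fun i j => m j i), ← LL_flip ε m x y]
  simp only [map_add, LinearMap.add_apply]
  ac_rfl

theorem LL_hom (ε : Module.Basis ι R V) (m : ι → ι → R) (a : R) (x : V) :
    LL ε m (a • x) (a • x) = a ^ 2 * LL ε m x x := by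
  simp; ring

/-- Diagonal matrix. -/
noncomputable def dg [DecidableEq ι] (d : ι → R) : ι → ι → R := fun i j => if i = j then d i else 0

/-- Strictly upper triangular part. -/
noncomputable def up [LinearOrder ι] (m : ι → ι → R) : ι → ι → R :=
  fun i j => if i < j then m i j else 0

theorem LL_dg [DecidableEq ι] (ε : Module.Basis ι R V) (d : ι → R) (x : V) :
    LL ε (dg d) x x = (ε.repr x).sum fun i c => c ^ 2 * d i := by
  rw [LL_apply]
  refine Finset.sum_congr rfl fun i hi => ?_
  change ∑ j ∈ (ε.repr x).support, _ = _
  rw [Finset.sum_eq_single i]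
  · simp [dg]; ring
  · intro j _ hj
    simp [dg, hj.symm]
  · intro h; exact absurd hi h

theorem LL_dg_add [DecidableEq ι] (h2 : ∀ a b : R, (a + b) ^ 2 = a ^ 2 + b ^ 2)
    (ε : Module.Basis ι R V) (d : ι → R) (x y : V) :
    LL ε (dg d) (x + y) (x + y) = LL ε (dg d) x x + LL ε (dg d) y y := by
  rw [LL_dg, LL_dg, LL_dg, map_add]
  refine Finsupp.sum_add_index' (fun i => by simp) fun i a b => ?_
  rw [h2, add_mul]

theorem dg_quasi [DecidableEq ι] (h2 : ∀ a b : R, (a + b) ^ 2 = a ^ 2 + b ^ 2)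
    (ε : Module.Basis ι R V) (d : ι → R) :
    IsQuasilinear (fun x => LL ε (dg d) x x) :=
  ⟨⟨LL_hom ε _, _, LL_comp ε _⟩, LL_dg_add h2 ε d⟩

theorem decomp [LinearOrder ι] (ε : Module.Basis ι R V) (q : V → R)
    (hq : ∀ (a : R) (x : V), q (a • x) = a ^ 2 * q x) (b : V → V → R) (hb : IsCompanion q b)
    (x : V) :
    q x = LL ε (dg fun i => q (ε i)) x x + LL ε (up fun i j => b (ε i) (ε j)) x x := by
  rw [← LL_add]
  set m : ι → ι → R := fun i j => dg (fun i => q (ε i)) i j + up (fun i j => b (ε i) (ε j)) i j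
    with hm
  suffices H : ∀ f : ι →₀ R, q (ε.repr.symm f) = LL ε m (ε.repr.symm f) (ε.repr.symm f) by
    simpa using H (ε.repr x)
  intro f
  induction f using Finsupp.induction with
  | zero => simpa using hq 0 0
  | single_add i a f hi ha ih =>
    have hc := (LL_comp ε m).2 (ε.repr.symm (Finsupp.single i a)) (ε.repr.symm f)
    have hc' := hb.2 (ε.repr.symm (Finsupp.single i a)) (ε.repr.symm f)
    unfold Accomp at hc hc'
    beta_reduce at hc
    rw [map_add, hc', hc, ih]
    have e1 : ε.repr.symm (Finsupp.single i a) = a • ε i := by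
      simp
    rw [e1]
    congr 1
    · congr 1
      rw [hq, LL_hom, LL_basis]
      simp [hm, dg, up]
    · conv_lhs => rw [symm_eq ε b hb.1]
      simp only [map_smul, LinearMap.smul_apply]
      congr 1
      have key : ∀ n : ι → ι → R, LL ε n (ε i) (ε.repr.symm f) = f.sum fun j d => d * n i j := by
        intro n
        unfold LL
        rw [Module.Basis.constr_basis, Module.Basis.constr_apply]
        simp
      rw [key, key]
      refine Finset.sum_congr rfl fun j hj => ?_
      have hij : i ≠ j := by rintro rfl; exact hi hj
      rcases lt_or_gt_of_ne hij with h | h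
      · simp [hm, dg, up, hij, hij.symm, h, h.not_gt]
      · simp [hm, dg, up, hij, hij.symm, h, h.not_gt, hb.1.1 (ε i) (ε j)]

theorem up_comp [LinearOrder ι] (ε : Module.Basis ι R V) (b : V → V → R) (hb : SymmBilin b)
    (h0 : ∀ i, b (ε i) (ε i) = 0) :
    IsCompanion (fun x => LL ε (up fun i j => b (ε i) (ε j)) x x) b := by
  have h := LL_comp ε (up fun i j => b (ε i) (ε j))
  convert h using 1
  conv_lhs => rw [symm_eq ε b hb]
  funext x y
  congr 3
  funext i j
  rcases lt_trichotomy i j with h | h | h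
  · simp [up, h, h.not_gt]
  · subst h; simp [up, h0]
  · simp [up, h, h.not_gt, hb.1 (ε i) (ε j)]

theorem up_basis [LinearOrder ι] (ε : Module.Basis ι R V) (m : ι → ι → R) (i : ι) :
    LL ε (up m) (ε i) (ε i) = 0 := by
  simp [LL_basis, up]

theorem up_uniq [LinearOrder ι] (ε : Module.Basis ι R V) (m : ι → ι → R) (b b' : V → V → R)
    (hb : IsCompanion (fun x => LL ε (up m) x x) b)
    (hb' : IsCompanion (fun x => LL ε (up m) x x) b') : b = b' := by
  have key : ∀ b : V → V → R, IsCompanion (fun x => LL ε (up m) x x) b → ∀ i j,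
      LL ε (up m) (ε i + ε j) (ε i + ε j) = b (ε i) (ε j) := by
    intro b hb i j
    have := hb.2 (ε i) (ε j)
    simpa only [Accomp, up_basis, zero_add] using this
  rw [symm_eq ε b hb.1, symm_eq ε b' hb'.1]
  funext x y
  congr 3
  funext i j
  rw [← key b hb, ← key b' hb']

end Helpers

/-- `b ↦ ρ_b` is a bijection from the off-diagonal companions of `q`
onto `Rig(q)`; moreover `b(ε_i, ε_j) = ρ_b(ε_i + ε_j)` for `i ≠ j`, and `b` is the
unique companion of `ρ_b`. -/
theorem stmt_8 {R V ι : Type*} [CommSemiring R] [AddCommMonoid V] [Module R V]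
    [LinearOrder ι]
    (h1 : ∀ a : R, a + a = 0 → a = 0)
    (h2 : ∀ a b : R, (a + b) ^ 2 = a ^ 2 + b ^ 2)
    (ε : Module.Basis ι R V) (q : V → R) (hq : IsQuadForm q)
    (ρdef : (V → V → R) → V → R)
    (hρdef : ∀ b x, ρdef b x = (ε.repr x).sum fun i c => (ε.repr x).sum fun j d =>
      if i < j then b (ε i) (ε j) * (c * d) else 0)
    (OffDiag : Set (V → V → R))
    (hOff : OffDiag = {b | IsCompanion q b ∧ ∀ i : ι, b (ε i) (ε i) = 0}) :
    Set.BijOn ρdef OffDiag (RigSet q) ∧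
    (∀ b ∈ OffDiag, ∀ i j : ι, i ≠ j → b (ε i) (ε j) = ρdef b (ε i + ε j)) ∧
    (∀ b ∈ OffDiag, IsCompanion (ρdef b) b ∧
      ∀ b' : V → V → R, IsCompanion (ρdef b) b' → b' = b) := by
  have hρ : ∀ b, ρdef b = fun x => LL ε (up fun i j => b (ε i) (ε j)) x x := by
    intro b
    funext x
    rw [hρdef, LL_apply]
    simp only [up, ite_mul, zero_mul]
  subst hOff
  have comp : ∀ b, SymmBilin b → (∀ i, b (ε i) (ε i) = 0) → IsCompanion (ρdef b) b := by
    intro b hb h0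
    rw [hρ]
    exact up_comp ε b hb h0
  have uniq : ∀ b b₁ b₂, IsCompanion (ρdef b) b₁ → IsCompanion (ρdef b) b₂ → b₁ = b₂ := by
    intro b b₁ b₂
    rw [hρ]
    exact up_uniq ε _ b₁ b₂
  refine ⟨⟨?_, ?_, ?_⟩, ?_, ?_⟩
  · rintro b ⟨hb, h0⟩
    refine ⟨⟨⟨?_, b, comp b hb.1 h0⟩, uniq b⟩, _, dg_quasi h2 ε (fun i => q (ε i)), ?_⟩
    · rw [hρ]; exact LL_hom ε _
    · rw [hρ]; exact decomp ε q hq.1 b hb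
  · rintro b ⟨hb, h0⟩ b' ⟨hb', h0'⟩ h
    refine uniq b b b' (comp b hb.1 h0) ?_
    rw [h]
    exact comp b' hb'.1 h0'
  · rintro ρ ⟨⟨⟨hρq, b, hb⟩, hrig⟩, c, hc, hqc⟩
    have hdec := decomp ε ρ hρq b hb
    set b0 : V → V → R := fun x y => LL ε
      (fun i j => if i = j then 0 else b (ε i) (ε j)) x y with hb0
    have hb0s : SymmBilin b0 := LL_symm ε _ fun i j => by
      simp only [eq_comm (a := i), hb.1.1 (ε i)]
    have hb00 : ∀ i, b0 (ε i) (ε i) = 0 := fun i => by simp [hb0, LL_basis]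
    have hup : (up fun i j => b0 (ε i) (ε j)) = up fun i j => b (ε i) (ε j) := by
      funext i j
      by_cases h : i < j
      · simp [up, h, hb0, LL_basis, h.ne]
      · simp [up, h]
    have hc0 : IsCompanion ρ b0 := by
      refine ⟨hb0s, fun x y => ?_⟩
      have := (up_comp ε b0 hb0s hb00).2 x y
      rw [hup] at this
      unfold Accomp at this ⊢
      beta_reduce at this
      rw [hdec (x + y), hdec x, hdec y, this, LL_dg_add h2]
      ac_rfl
    have hbb : b = b0 := hrig _ _ hb hc0
    have hbd : ∀ i, b (ε i) (ε i) = 0 := by rw [hbb]; exact hb00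
    have hd : ∀ i, ρ (ε i) = 0 := by
      intro i
      have h := LL_comp ε (fun i j => dg (fun i => ρ (ε i)) i j + up (fun i j => b (ε i) (ε j)) i j)
      have e : (fun x => LL ε (fun i j => dg (fun i => ρ (ε i)) i j +
          up (fun i j => b (ε i) (ε j)) i j) x x) = ρ := by
        funext x
        rw [LL_add, ← hdec]
      rw [e] at h
      have h' := congrFun (congrFun (hrig _ _ hb h) (ε i)) (ε i)
      rw [hbd, LL_basis] at h'
      apply h1
      simpa [dg, up] using h'.symm
    refine ⟨b, ⟨⟨hb.1, fun x y => ?_⟩, hbd⟩, ?_⟩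
    · have := hb.2 x y
      unfold Accomp at this ⊢
      rw [hqc, hqc x, hqc y, hc.2, this]
      ac_rfl
    · rw [hρ]
      funext x
      rw [hdec x, LL_dg]
      simp [hd]
  · rintro b ⟨hb, h0⟩ i j hij
    have := (comp b hb.1 h0).2 (ε i) (ε j)
    unfold Accomp at this
    rw [this, hρ]
    simp only [up_basis, zero_add]
  · rintro b ⟨hb, h0⟩
    exact ⟨comp b hb.1 h0, fun b' hb' => uniq b b' b hb' (comp b hb.1 h0)⟩
end

section
/- Let R be a supertropical semiring with e := 1 + 1. Then: (a) R is upper bound, i.e. the relation x ≤ y iff x + z = y for some z ∈ R is antisymmetric; and (b) for all x, y ∈ R, if ex + z = ey for some z ∈ R, then ex + ez' = ey for some z' ∈ R (the restriction of the minimal ordering of R to eR is the minimal ordering of the semiring eR). -/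
/-- A supertropical semiring is upper bound, and the restriction of its
minimal ordering to the ghost ideal `eR` is the minimal ordering of `eR`. -/
theorem stmt_9 {R : Type*} [CommSemiring R] (hR : IsSupertropical R) :
    IsUB R ∧
    ∀ x y : R, (∃ z : R, ((1 : R) + 1) * x + z = ((1 : R) + 1) * y) →
      ∃ z' : R, ((1 : R) + 1) * x + ((1 : R) + 1) * z' = ((1 : R) + 1) * y := by
  obtain ⟨h0, h1, h2⟩ := hR
  have hee : ((1 : R) + 1) * (1 + 1) = 1 + 1 := by
    rw [mul_add, mul_one, h0]
  have hid : ∀ x : R, ((1 : R) + 1) * x + (1 + 1) * x = (1 + 1) * x := by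
    intro x
    rw [← add_mul, h0]
  refine ⟨?_, ?_⟩
  · rintro x y ⟨z, hz⟩ ⟨w, hw⟩
    have a1 : ((1 : R) + 1) * x + (1 + 1) * y = (1 + 1) * y := by
      rw [← hz, mul_add, ← add_assoc, hid]
    have a2 : ((1 : R) + 1) * y + (1 + 1) * x = (1 + 1) * x := by
      rw [← hw, mul_add, ← add_assoc, hid]
    have hxy : ((1 : R) + 1) * x = (1 + 1) * y := by
      exact a2.symm.trans ((add_comm _ _).trans a1)
    by_cases c : ((1 : R) + 1) * x = (1 + 1) * z
    · have hy : y = (1 + 1) * z := by rw [← hz]; exact h2 _ _ c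
      by_cases d : ((1 : R) + 1) * y = (1 + 1) * w
      · have hx : x = (1 + 1) * w := by rw [← hw]; exact h2 _ _ d
        rw [hx, ← d, ← hxy, c, ← hy]
      · rcases h1 _ _ d with h | h
        · exact hw.symm.trans h
        · exact absurd (by rw [← hxy, ← hw.symm.trans h]) d
    · rcases h1 _ _ c with h | h
      · exact h.symm.trans hz
      · exact absurd (by rw [hxy, ← hz.symm.trans h]) c
  · rintro x y ⟨z, hz⟩
    refine ⟨z, ?_⟩
    have := congrArg (fun t => ((1 : R) + 1) * t) hz
    simpa only [mul_add ((1 : R) + 1) (((1 : R) + 1) * x) z, ← mul_assoc, hee] using this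
end

section
/- Let R be a commutative semiring, V a free R-module with basis (ε_i)_{i∈I}, and q a quadratic form on V. A symmetric bilinear form b on V is a companion of q if and only if for every pair (i,j) ∈ I × I, b accompanies q on Rε_i × Rε_j. Consequently, the companions of q correspond bijectively to the symmetric families (β_{i,j})_{(i,j)∈I×I} in R with β_{i,j} ∈ C_{i,j}(q) and β_{i,j} = β_{j,i} for all i, j, via b ↦ (b(ε_i, ε_j)). -/
section Helpers

variable {R V ι : Type*} [CommSemiring R] [AddCommMonoid V] [Module R V]

theorem hp_smul_right {b : V → V → R} (hb : SymmBilin b) (a : R) (x y : V) :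
    b x (a • y) = a * b x y := by
  rw [hb.1, hb.2.1, hb.1]

theorem hp_add_right {b : V → V → R} (hb : SymmBilin b) (x y z : V) :
    b x (y + z) = b x y + b x z := by
  rw [hb.1, hb.2.2, hb.1 y, hb.1 z]

theorem hp_zero_left {b : V → V → R} (hb : SymmBilin b) (y : V) : b 0 y = 0 := by
  have := hb.2.1 0 0 y
  simpa using this

theorem hp_ind (ε : Module.Basis ι R V) (P : V → Prop) (h0 : P 0)
    (hadd : ∀ x y, P x → P y → P (x + y)) (hs : ∀ (a : R) (i : ι), P (a • ε i)) (x : V) : P x := by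
  rw [← ε.linearCombination_repr x, Finsupp.linearCombination_apply]
  exact Finset.sum_induction _ P hadd h0 (fun i _ => hs _ i)

theorem hp_main (ε : Module.Basis ι R V) (q : V → R) (b₀ b : V → V → R)
    (h₀ : IsCompanion q b₀) (hb : SymmBilin b)
    (h : ∀ i j : ι, ∀ a c : R, Accomp q b (a • ε i) (c • ε j)) (x y : V) : Accomp q b x y := by
  have add : ∀ y x x' : V, Accomp q b x y → Accomp q b x' y → Accomp q b (x + x') y := by
    intro y x x' h1 h2
    unfold Accomp at *
    have e := h₀.2
    unfold Accomp at e
    rw [e] at h1 h2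
    rw [e, e x x', h₀.1.2.2, hb.2.2]
    calc q x + q x' + b₀ x x' + q y + (b₀ x y + b₀ x' y)
        = (q x + q y + b₀ x y) + (q x' + b₀ x x' + b₀ x' y) := by ring
      _ = (q x' + q y + b₀ x' y) + (q x + b₀ x x' + b x y) := by rw [h1]; ring
      _ = _ := by rw [h2]; ring
  have q0 : ∀ y, Accomp q b 0 y := by
    intro y
    have e := h₀.2 0 y
    unfold Accomp at *
    rw [e, hp_zero_left h₀.1, hp_zero_left hb]
  have sy : ∀ x y, Accomp q b x y → Accomp q b y x := by
    intro x y h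
    unfold Accomp at *
    rw [add_comm, h, hb.1 x y]; ring
  refine hp_ind ε (fun x => Accomp q b x y) (q0 y) (add y) (fun a i => ?_) x
  refine sy _ _ ?_
  exact hp_ind ε (fun y => Accomp q b y (a • ε i)) (q0 _) (add _) (fun c j => h j i c a) y

end Helpers

/-- A symmetric bilinear form is a companion of `q` iff it accompanies `q`
on each `Rε_i × Rε_j`; consequently the companions of `q` correspond bijectively to the
symmetric families `(β_{i,j})` with `β_{i,j} ∈ C_{i,j}(q)`. -/
theorem stmt_10 {R V ι : Type*} [CommSemiring R] [AddCommMonoid V] [Module R V]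
    (ε : Module.Basis ι R V) (q : V → R) (hq : IsQuadForm q) :
    (∀ b : V → V → R, SymmBilin b →
      ((∀ x y : V, Accomp q b x y) ↔
        ∀ i j : ι, ∀ a c : R, Accomp q b (a • ε i) (c • ε j))) ∧
    Set.BijOn (fun (b : V → V → R) (p : ι × ι) => b (ε p.1) (ε p.2))
      {b : V → V → R | IsCompanion q b}
      {β : ι × ι → R | (∀ i j : ι, β (i, j) ∈ companionSet q (ε i) (ε j)) ∧
        ∀ i j : ι, β (i, j) = β (j, i)} := by
  obtain ⟨-, b₀, h₀⟩ := hq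
  refine ⟨fun b hb => ⟨fun h i j a c => h _ _, hp_main ε q b₀ b h₀ hb⟩, ?_, ?_, ?_⟩
  · intro b hb
    exact ⟨fun i j => ⟨b, hb.1, fun a c => hb.2 _ _, rfl⟩, fun i j => hb.1.1 _ _⟩
  · intro b hb b' hb' hbb
    have hb := hb.1
    have hb' := hb'.1
    funext x y
    refine hp_ind ε (fun x => b x y = b' x y) ?_ ?_ (fun a i => ?_) x
    · simp only [hp_zero_left hb, hp_zero_left hb']
    · intro x x' h h'
      simp only [hb.2.2, hb'.2.2, h, h']
    · refine hp_ind ε (fun y => b (a • ε i) y = b' (a • ε i) y) ?_ ?_ (fun c j => ?_) y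
      · simp only [hb.1 _ 0, hb'.1 _ 0, hp_zero_left hb, hp_zero_left hb']
      · intro x x' h h'
        simp only [hp_add_right hb, hp_add_right hb', h, h']
      · have := congrFun hbb (i, j)
        simp only at this
        simp only [hb.2.1, hb'.2.1, hp_smul_right hb, hp_smul_right hb', this]
  · rintro β ⟨hβ, hs⟩
    let B : V →ₗ[R] V →ₗ[R] R := ε.constr R (fun i => ε.constr R (fun j => β (i, j)))
    have hB : ∀ i j, B (ε i) (ε j) = β (i, j) := by
      intro i j
      simp only [B, Module.Basis.constr_basis]
    have hfl : B = B.flip := by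
      refine ε.ext fun i => ε.ext fun j => ?_
      rw [LinearMap.flip_apply, hB, hB, hs]
    have hSB : SymmBilin (fun x y => B x y) := by
      refine ⟨fun x y => ?_, fun a x y => ?_, fun x x' y => ?_⟩
      · change B x y = B y x
        conv_lhs => rw [hfl]
        rfl
      · simp
      · simp
    refine ⟨fun x y => B x y, ⟨hSB, hp_main ε q b₀ _ h₀ hSB ?_⟩, ?_⟩
    · intro i j a c
      obtain ⟨b', hb', hac, hv⟩ := hβ i j
      have := hac a c
      unfold Accomp at *
      rw [this, hb'.2.1, hp_smul_right hb', hv]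
      simp [hB]
      ring
    · funext p
      exact hB p.1 p.2
end

section
/- Let R be an upper bound commutative semiring, V a free R-module with basis (ε_i)_{i∈I}, and q a quadratic form on V. Then each set C_{i,j}(q) is convex in R: if β₁, β₂ ∈ C_{i,j}(q) and γ ∈ R satisfies β₁ ≤ γ ≤ β₂ in the minimal ordering of R, then γ ∈ C_{i,j}(q). -/
theorem conv_aux {R V : Type*} [CommSemiring R] [AddCommMonoid V] [Module R V]
    (hub : IsUB R) (q : V → R) (u v : V) (β₁ β₂ γ : R)
    (hβ₁ : β₁ ∈ companionSet q u v) (hβ₂ : β₂ ∈ companionSet q u v)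
    (h₁ : mle β₁ γ) (h₂ : mle γ β₂) (b : V → V → R) (hb : SymmBilin b) (hv : b u v = γ) :
    γ ∈ companionSet q u v := by
  have key : ∀ b : V → V → R, SymmBilin b → ∀ a c : R, b (a • u) (c • v) = a * c * b u v := by
    intro b hb a c
    rw [hb.2.1, hb.1, hb.2.1, hb.1 v u, mul_assoc]
  obtain ⟨b₁, hb₁, ha₁, rfl⟩ := hβ₁
  obtain ⟨b₂, hb₂, ha₂, rfl⟩ := hβ₂
  obtain ⟨z, hz⟩ := h₁
  obtain ⟨w, hw⟩ := h₂
  refine ⟨b, hb, fun a c => ?_, hv⟩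
  have e₁ := ha₁ a c
  have e₂ := ha₂ a c
  unfold Accomp at *
  rw [key _ hb₁] at e₁
  rw [key _ hb₂] at e₂
  rw [key _ hb, hv]
  apply hub
  · exact ⟨a * c * z, by rw [e₁, ← hz]; ring⟩
  · exact ⟨a * c * w, by rw [e₂, ← hw]; ring⟩

/-- Over an upper bound semiring, each set `C_{i,j}(q)` is convex in the
minimal ordering. -/
theorem stmt_11 {R V ι : Type*} [CommSemiring R] [AddCommMonoid V] [Module R V]
    (hub : IsUB R) (ε : Module.Basis ι R V) (q : V → R) (hq : IsQuadForm q)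
    (i j : ι) (β₁ β₂ γ : R)
    (hβ₁ : β₁ ∈ companionSet q (ε i) (ε j)) (hβ₂ : β₂ ∈ companionSet q (ε i) (ε j))
    (h₁ : mle β₁ γ) (h₂ : mle γ β₂) :
    γ ∈ companionSet q (ε i) (ε j) := by
  classical
  by_cases hij : i = j
  · subst hij
    refine conv_aux hub q _ _ β₁ β₂ γ hβ₁ hβ₂ h₁ h₂
      (fun x y => γ * (ε.repr x i * ε.repr y i)) ⟨?_, ?_, ?_⟩ ?_
    · intro x y; ring
    · intro a x y; simp; ring
    · intro x x' y; simp; ring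
    · simp
  · refine conv_aux hub q _ _ β₁ β₂ γ hβ₁ hβ₂ h₁ h₂
      (fun x y => γ * (ε.repr x i * ε.repr y j + ε.repr x j * ε.repr y i)) ⟨?_, ?_, ?_⟩ ?_
    · intro x y; ring
    · intro a x y; simp; ring
    · intro x x' y; simp; ring
    · simp [Finsupp.single_apply, hij]
end

section
/- Let R be a commutative semiring, V an R-module, q a quadratic form on V, T ⊆ V × V a set on which q is quasilinear, and b₁, b₂ symmetric bilinear forms on V. Then: (a) if b₁ and b₂ both accompany q on T, then b₁ + b₂ accompanies q on T; (b) if R is upper bound and b₁ + b₂ accompanies q on T, then both b₁ and b₂ accompany q on T. -/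
/-- If `q` is quasilinear on `T`, then (a) the sum of two companions of `q`
on `T` is a companion of `q` on `T`; (b) over an upper bound semiring, if `b₁ + b₂` is a
companion of `q` on `T` then so are `b₁` and `b₂`. -/
theorem stmt_12 {R V : Type*} [CommSemiring R] [AddCommMonoid V] [Module R V]
    (q : V → R) (hq : IsQuadForm q) (T : Set (V × V))
    (hql : ∀ p ∈ T, q (p.1 + p.2) = q p.1 + q p.2)
    (b₁ b₂ : V → V → R) (hb₁ : SymmBilin b₁) (hb₂ : SymmBilin b₂) :
    ((∀ p ∈ T, Accomp q b₁ p.1 p.2) → (∀ p ∈ T, Accomp q b₂ p.1 p.2) →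
        ∀ p ∈ T, Accomp q (fun x y => b₁ x y + b₂ x y) p.1 p.2) ∧
    (IsUB R → (∀ p ∈ T, Accomp q (fun x y => b₁ x y + b₂ x y) p.1 p.2) →
        (∀ p ∈ T, Accomp q b₁ p.1 p.2) ∧ (∀ p ∈ T, Accomp q b₂ p.1 p.2)) := by
  refine ⟨fun h1 h2 p hp => ?_, fun hub h => ⟨fun p hp => ?_, fun p hp => ?_⟩⟩
  · have e1 := h1 p hp
    have e2 := h2 p hp
    have e := hql p hp
    unfold Accomp at *
    rw [← add_assoc, ← e1, e]
    rw [e] at e2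
    exact e2
  · have e1 := h p hp
    have e := hql p hp
    unfold Accomp at *
    rw [e] at e1 ⊢
    exact hub _ _ ⟨_, rfl⟩ ⟨b₂ p.1 p.2, by rw [add_assoc]; exact e1.symm⟩
  · have e1 := h p hp
    have e := hql p hp
    unfold Accomp at *
    rw [e] at e1 ⊢
    exact hub _ _ ⟨_, rfl⟩
      ⟨b₁ p.1 p.2, by rw [add_assoc, add_comm (b₂ p.1 p.2)]; exact e1.symm⟩
end

section
/- Let R be a supertropical semiring, V a free R-module with basis (ε_i)_{i∈I}, and q a quadratic form on V. Then for every i ∈ I, C_{i,i}(q) = {β ∈ R | β ≤ e·q(ε_i)}, where ≤ is the minimal ordering of R and e = 1 + 1. -/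
/-- Over a supertropical semiring, `C_{i,i}(q) = {β | 0 ≤ β ≤ e·q(ε_i)}`
in the minimal ordering. -/
theorem stmt_13 {R V ι : Type*} [CommSemiring R] [AddCommMonoid V] [Module R V]
    (hR : IsSupertropical R) (ε : Module.Basis ι R V) (q : V → R) (hq : IsQuadForm q) (i : ι) :
    companionSet q (ε i) (ε i) = {β : R | mle β (((1 : R) + 1) * q (ε i))} := by
  obtain ⟨h0, h1, h2⟩ := hR
  obtain ⟨hq, -⟩ := hq
  have ee : ((1 : R) + 1) * (1 + 1) = 1 + 1 := by
    rw [mul_add, mul_one]; exact h0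
  have half : ∀ a c : R, a + c = a → (a + c) ^ 2 = a ^ 2 + c ^ 2 := by
    intro a c h
    have e1 : a ^ 2 = a ^ 2 + a * c := by
      calc a ^ 2 = a * (a + c) := by rw [h]; ring
        _ = _ := by ring
    have e2 : a * c = a * c + c ^ 2 := by
      calc a * c = (a + c) * c := by rw [h]
        _ = _ := by ring
    calc (a + c) ^ 2 = a ^ 2 + a * c := by rw [h]; exact e1
      _ = a ^ 2 + (a * c + c ^ 2) := by rw [← e2]
      _ = (a ^ 2 + a * c) + c ^ 2 := by ring
      _ = _ := by rw [← e1]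
  have sq : ∀ a c : R, (a + c) ^ 2 = a ^ 2 + c ^ 2 := by
    intro a c
    by_cases h : ((1 : R) + 1) * a = (1 + 1) * c
    · have h' : ((1 : R) + 1) * a ^ 2 = (1 + 1) * c ^ 2 := by
        calc ((1 : R) + 1) * a ^ 2 = ((1 + 1) * a) * a := by ring
          _ = ((1 + 1) * a) * c := by rw [h]; rw [mul_right_comm, h]
          _ = _ := by rw [h]; ring
      rw [h2 _ _ h, h2 _ _ h', mul_pow, pow_two (1 + 1 : R), ee]
    · rcases h1 a c h with h | h
      · exact half a c h
      · rw [add_comm, half c a (by rw [add_comm]; exact h), add_comm]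
  ext β
  constructor
  · rintro ⟨b, -, hb, rfl⟩
    have := hb 1 1
    unfold Accomp at this
    rw [← add_smul, hq, one_smul, pow_two, ee] at this
    refine ⟨(1 + 1) * q (ε i), ?_⟩
    rw [add_comm]
    conv_rhs => rw [this]
    rw [add_mul, one_mul]
  · rintro ⟨z, hz⟩
    have key : (1 + 1) * q (ε i) + β = (1 + 1) * q (ε i) := by
      by_cases h : ((1 : R) + 1) * β = (1 + 1) * z
      · have hz' := h2 _ _ h
        rw [add_comm, h2 β _ (by rw [← hz, hz', ← mul_assoc, ee, h]), ← mul_assoc, ee]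
      · rcases h1 β z h with h | h
        · rw [hz] at h
          rw [← h, ← add_mul, h0]
        · rw [hz] at h
          rw [← h] at hz
          rw [add_comm]; exact hz
    refine ⟨fun x y => ε.repr x i * ε.repr y i * β, ⟨?_, ?_, ?_⟩, ?_, ?_⟩
    · intro x y; ring
    · intro a x y; simp [mul_assoc]
    · intro x x' y; simp [add_mul]
    · intro a c
      simp only [Accomp]
      rw [← add_smul, hq, hq, hq]
      simp only [map_smul, Module.Basis.repr_self, Finsupp.smul_apply, Finsupp.single_eq_same,
        smul_eq_mul, mul_one]
      rw [← add_mul, ← sq]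
      calc (a + c) ^ 2 * q (ε i)
          = a ^ 2 * q (ε i) + c ^ 2 * q (ε i) + a * c * ((1 + 1) * q (ε i)) := by ring
        _ = a ^ 2 * q (ε i) + c ^ 2 * q (ε i) + a * c * ((1 + 1) * q (ε i) + β) := by rw [key]
        _ = _ := by ring
    · simp
end

section
/- Let R be a supertropical semiring such that every nonzero element of eR is of the form e·t with t ∈ T(R) := R \ eR (i.e. e·T(R) = G(R)). Let V be a free R-module with basis (ε_i)_{i∈I} and q a quadratic form on V. If a symmetric bilinear form b on V accompanies q on the set ⋃_{i∈I} T(R)·ε_i, i.e. q(λε_i + με_j) = q(λε_i) + q(με_j) + b(λε_i, με_j) for all i, j ∈ I and all tangible λ, μ ∈ T(R), then b is a companion of q. -/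
/-- Over a supertropical semiring with `e·T(R) = G(R)`, a symmetric
bilinear form accompanying `q` on `⋃_i T(R)·ε_i` is a companion of `q`. -/
theorem stmt_14 {R V ι : Type*} [CommSemiring R] [AddCommMonoid V] [Module R V]
    (hR : IsSupertropical R)
    (htang : ∀ g ∈ ghost R, g ≠ 0 → ∃ t, t ∉ ghost R ∧ ((1 : R) + 1) * t = g)
    (ε : Module.Basis ι R V) (q : V → R) (hq : IsQuadForm q)
    (b : V → V → R) (hb : SymmBilin b)
    (hacc : ∀ i j : ι, ∀ lam mu : R, lam ∉ ghost R → mu ∉ ghost R →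
      q (lam • ε i + mu • ε j) = q (lam • ε i) + q (mu • ε j) + b (lam • ε i) (mu • ε j)) :
    ∀ x y : V, Accomp q b x y := by
  obtain ⟨hq2, b0, ⟨hs0, hm0, ha0⟩, hc0⟩ := hq
  obtain ⟨hs, hm, ha⟩ := hb
  have ee : ((1 : R) + 1) * (1 + 1) = 1 + 1 := by
    have := hR.1
    rw [mul_add, mul_one]; exact this
  -- double the bilinear term
  have key : ∀ A B C D : R, A + B + C = A + B + D → A + B + (1 + 1) * C = A + B + (1 + 1) * D := by
    intro A B C D h
    calc A + B + (1 + 1) * C = (A + B + C) + C := by ring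
      _ = (A + B + C) + D := by rw [h]; rw [add_right_comm, h]
      _ = (A + B + D) + D := by rw [h]
      _ = _ := by ring
  have z : ∀ y, b 0 y = 0 := fun y => by simpa using hm 0 0 y
  have z0 : ∀ y, b0 0 y = 0 := fun y => by simpa using hm0 0 0 y
  have hmr : ∀ (a : R) x y, b x (a • y) = a * b x y := fun a x y => by rw [hs, hm, hs]
  have hmr0 : ∀ (a : R) x y, b0 x (a • y) = a * b0 x y := fun a x y => by rw [hs0, hm0, hs0]
  have har : ∀ x y y', b x (y + y') = b x y + b x y' := fun x y y' => by
    rw [hs, ha, hs y, hs y']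
  have har0 : ∀ x y y', b0 x (y + y') = b0 x y + b0 x y' := fun x y y' => by
    rw [hs0, ha0, hs0 y, hs0 y']
  have tt : ∀ i j (l m : R), l ∉ ghost R → m ∉ ghost R →
      l ^ 2 * q (ε i) + m ^ 2 * q (ε j) + l * (m * b0 (ε i) (ε j)) =
      l ^ 2 * q (ε i) + m ^ 2 * q (ε j) + l * (m * b (ε i) (ε j)) := by
    intro i j l m hl hm'
    have h1 := hacc i j l m hl hm'
    have h2 := hc0 (l • ε i) (m • ε j)
    unfold Accomp at h2
    rw [h2, hq2, hq2, hm, hm0, hmr, hmr0] at h1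
    exact h1
  have gt : ∀ i j (l m : R), m ∉ ghost R →
      l ^ 2 * q (ε i) + m ^ 2 * q (ε j) + l * (m * b0 (ε i) (ε j)) =
      l ^ 2 * q (ε i) + m ^ 2 * q (ε j) + l * (m * b (ε i) (ε j)) := by
    intro i j l m hm'
    by_cases hl : l ∈ ghost R
    · by_cases hl0 : l = 0
      · simp [hl0]
      obtain ⟨t, ht, rfl⟩ := htang l hl hl0
      have h := key _ _ _ _ (tt i j t m ht hm')
      have e2 : ((1 + 1) * t) ^ 2 * q (ε i) = t ^ 2 * q (ε i) + t ^ 2 * q (ε i) := by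
        rw [mul_pow, sq (1 + 1 : R), ee]; ring
      rw [e2, mul_assoc, mul_assoc, add_assoc (t ^ 2 * q (ε i)), add_assoc (t ^ 2 * q (ε i)), h,
        ← add_assoc, ← add_assoc]
    · exact tt i j l m hl hm'
  have gg : ∀ i j (l m : R),
      l ^ 2 * q (ε i) + m ^ 2 * q (ε j) + l * (m * b0 (ε i) (ε j)) =
      l ^ 2 * q (ε i) + m ^ 2 * q (ε j) + l * (m * b (ε i) (ε j)) := by
    intro i j l m
    by_cases hl : m ∈ ghost R
    · by_cases hl0 : m = 0
      · simp [hl0]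
      obtain ⟨t, ht, rfl⟩ := htang m hl hl0
      have h := key _ _ _ _ (gt i j l t ht)
      have e2 : ((1 + 1) * t) ^ 2 * q (ε j) = t ^ 2 * q (ε j) + t ^ 2 * q (ε j) := by
        rw [mul_pow, sq (1 + 1 : R), ee]; ring
      rw [e2]
      calc _ = t ^ 2 * q (ε j) + (l ^ 2 * q (ε i) + t ^ 2 * q (ε j)
              + (1 + 1) * (l * (t * b0 (ε i) (ε j)))) := by ring
        _ = _ := by rw [h]; ring
    · exact gt i j l m hl
  have abs : ∀ (x : V) i, ∃ r, q x = (ε.repr x i) ^ 2 * q (ε i) + r := by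
    intro x i
    have hx : x = ε.repr x i • ε i + ε.repr.symm ((ε.repr x).erase i) := by
      apply ε.repr.injective
      rw [map_add, map_smul, ε.repr_self, LinearEquiv.apply_symm_apply,
        Finsupp.smul_single, smul_eq_mul, mul_one, Finsupp.single_add_erase]
    have h := hc0 (ε.repr x i • ε i) (ε.repr.symm ((ε.repr x).erase i))
    unfold Accomp at h
    rw [← hx, hq2, add_assoc] at h
    exact ⟨_, h⟩
  intro x y
  have h1 : ∀ i j, q x + q y + b0 (ε.repr x i • ε i) (ε.repr y j • ε j) =
      q x + q y + b (ε.repr x i • ε i) (ε.repr y j • ε j) := by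
    intro i j
    obtain ⟨r, hr⟩ := abs x i
    obtain ⟨s, hs'⟩ := abs y j
    rw [hr, hs', hm, hm0, hmr, hmr0]
    have h := gg i j (ε.repr x i) (ε.repr y j)
    rw [add_add_add_comm, add_right_comm, h, add_right_comm]
  have h2 : ∀ j (s : Finset ι),
      q x + q y + b0 (∑ i ∈ s, ε.repr x i • ε i) (ε.repr y j • ε j) =
      q x + q y + b (∑ i ∈ s, ε.repr x i • ε i) (ε.repr y j • ε j) := by
    intro j s
    classical
    induction s using Finset.induction_on with
    | empty => simp [z, z0]
    | insert i s hi ih =>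
      rw [Finset.sum_insert hi, ha, ha0, ← add_assoc, h1, add_right_comm, ih, add_right_comm,
        ← add_assoc]
  have hx : ∑ i ∈ (ε.repr x).support, ε.repr x i • ε i = x := by
    simpa [Finsupp.linearCombination_apply, Finsupp.sum] using ε.linearCombination_repr x
  have hy : ∑ i ∈ (ε.repr y).support, ε.repr y i • ε i = y := by
    simpa [Finsupp.linearCombination_apply, Finsupp.sum] using ε.linearCombination_repr y
  have h3 : ∀ (s : Finset ι),
      q x + q y + b0 x (∑ i ∈ s, ε.repr y i • ε i) =
      q x + q y + b x (∑ i ∈ s, ε.repr y i • ε i) := by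
    intro s
    classical
    induction s using Finset.induction_on with
    | empty => simp [z, z0, hs x, hs0 x]
    | insert i s hi ih =>
      have h := h2 i (ε.repr x).support
      rw [hx] at h
      rw [Finset.sum_insert hi, har, har0, ← add_assoc, h, add_right_comm, ih, add_right_comm,
        ← add_assoc]
  have h := h3 (ε.repr y).support
  rw [hy] at h
  exact (hc0 x y).trans h
end

section
/- Let R be a nontrivial tangible supersemifield and let q be the quadratic form on the free module V = Rε₁ ⊕ Rε₂ given by q(x₁ε₁ + x₂ε₂) = α₁x₁² + α₂x₂² + αx₁x₂, where α₁, α₂, α ∈ R satisfy α² >_ν α₁α₂. Then C_{1,2}(q) = {α}, except in the following case: R is discrete, α₁α₂ is not a ν-square, and α² ≅_ν π⁻¹α₁α₂ for a prime element π of R. In that exceptional case, if α₁ ∈ eR and α₂ ∈ eR then C_{1,2}(q) = {β ∈ R | β ≤ eα in the minimal ordering of R}, while if α₁ ∉ eR or α₂ ∉ eR then C_{1,2}(q) = {β ∈ R | β ≅_ν α}. -/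
section Supersemifield

variable {R : Type*}

/-- `R` is a nontrivial tangible supersemifield. -/
def IsNTSupersemifield (R : Type*) [CommSemiring R] : Prop :=
  IsSupertropical R ∧
  (∀ x : R, x ∉ ghost R → IsUnit x) ∧
  (∀ g ∈ ghost R, g ≠ 0 → ∃ g' ∈ ghost R, g * g' = (1 : R) + 1) ∧
  (∀ g ∈ ghost R, g ≠ 0 → ∃ t, t ∉ ghost R ∧ ((1 : R) + 1) * t = g) ∧
  (∃ g ∈ ghost R, g ≠ 0 ∧ g ≠ (1 : R) + 1)

/-- The ordering `a ≤ b` iff `a + b = b` (used on the ghost ideal). -/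
def gle [CommSemiring R] (a b : R) : Prop := a + b = b

/-- The strict ordering `a < b` on the ghost ideal. -/
def glt [CommSemiring R] (a b : R) : Prop := a + b = b ∧ a ≠ b

/-- `R` is dense: the nonzero ghosts are densely ordered. -/
def DenseR (R : Type*) [CommSemiring R] : Prop :=
  ∀ x ∈ ghost R, x ≠ 0 → ∀ y ∈ ghost R, y ≠ 0 → glt x y →
    ∃ z ∈ ghost R, z ≠ 0 ∧ glt x z ∧ glt z y

/-- `R` is discrete: every nonzero ghost has a largest nonzero ghost below it. -/
def DiscreteR (R : Type*) [CommSemiring R] : Prop :=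
  ∀ x ∈ ghost R, x ≠ 0 → ∃ x' ∈ ghost R, x' ≠ 0 ∧ glt x' x ∧
    ∀ y ∈ ghost R, y ≠ 0 → glt y x → gle y x'

/-- A prime element: a tangible `π` with `eπ` the largest ghost smaller than `e`. -/
def IsPrimeElem [CommSemiring R] (p : R) : Prop :=
  p ∉ ghost R ∧ glt (((1 : R) + 1) * p) ((1 : R) + 1) ∧
  ∀ y ∈ ghost R, y ≠ 0 → glt y ((1 : R) + 1) → gle y (((1 : R) + 1) * p)

/-- `a ≅_ν b` : `ea = eb`. -/
def nueq [CommSemiring R] (a b : R) : Prop := ((1 : R) + 1) * a = ((1 : R) + 1) * b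

/-- `a ≤_ν b` : `ea ≤ eb` in the total order of the ghost ideal. -/
def nule [CommSemiring R] (a b : R) : Prop :=
  ((1 : R) + 1) * a + ((1 : R) + 1) * b = ((1 : R) + 1) * b

/-- `a <_ν b`. -/
def nult [CommSemiring R] (a b : R) : Prop := nule a b ∧ ¬ nueq a b

/-- `a` is a ν-square. -/
def IsNuSquare [CommSemiring R] (a : R) : Prop :=
  ∃ b : R, ((1 : R) + 1) * a = ((1 : R) + 1) * b ^ 2

end Supersemifield


universe u

/-- The value data of a supersemifield. -/
structure SVal (R Γ : Type*) [CommSemiring R] [LinearOrderedCommGroupWithZero Γ] where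
  ν : R → Γ
  map_mul : ∀ x y, ν (x * y) = ν x * ν y
  map_one : ν 1 = 1
  map_zero : ν 0 = 0
  eq_zero : ∀ x, ν x = 0 → x = 0
  eq_iff : ∀ x y, ν x = ν y ↔ ((1 : R) + 1) * x = ((1 : R) + 1) * y
  le_iff : ∀ x y, ν x ≤ ν y ↔ ((1 : R) + 1) * x + ((1 : R) + 1) * y = ((1 : R) + 1) * y
  surj : ∀ γ, γ ≠ 0 → ∃ t, IsUnit t ∧ t ∉ ghost R ∧ ν t = γ
  nontriv : ∃ γ : Γ, γ ≠ 0 ∧ γ ≠ 1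

theorem ee_eq {R : Type*} [CommSemiring R] (h : IsSupertropical R) :
    ((1 : R) + 1) * ((1 : R) + 1) = (1 : R) + 1 := by
  rw [mul_add, mul_one]; exact h.1

theorem e_idem {R : Type*} [CommSemiring R] (h : IsSupertropical R) (x : R) :
    ((1 : R) + 1) * (((1 : R) + 1) * x) = ((1 : R) + 1) * x := by
  rw [← mul_assoc, ee_eq h]

theorem mem_ghost_iff {R : Type*} [CommSemiring R] (h : IsSupertropical R) (x : R) :
    x ∈ ghost R ↔ ((1 : R) + 1) * x = x := by
  constructor
  · rintro ⟨r, rfl⟩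
    exact e_idem h r
  · intro h; exact ⟨x, h⟩

theorem exists_SVal {R : Type u} [CommSemiring R] (hR : IsNTSupersemifield R) :
    ∃ (Γ : Type u) (_ : LinearOrderedCommGroupWithZero Γ), Nonempty (SVal R Γ) := by
  classical
  obtain ⟨hs, hu, hinv, htan, g0, hg0, hg00, hg01⟩ := hR
  have hadd : ∀ x y : R, ((1 : R) + 1) * x ≠ ((1 : R) + 1) * y → x + y = x ∨ x + y = y := hs.2.1
  have hadd' := hs.2.2
  have mg := mem_ghost_iff hs
  have he0 : (1 : R) + 1 ≠ 0 := by
    intro h; apply hg00; rw [← (mg g0).1 hg0, h, zero_mul]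
  have hidem : ∀ x ∈ ghost R, x + x = x := by
    intro x hx
    rw [hadd' x x rfl]; exact (mg x).1 hx
  let Γ := {x : R // x ∈ ghost R}
  have tot : ∀ a b : Γ, a.1 + b.1 = b.1 ∨ b.1 + a.1 = a.1 := by
    rintro ⟨a, ha⟩ ⟨b, hb⟩
    by_cases hab : a = b
    · left; subst hab; exact hidem a ha
    · rcases hadd a b (by rw [(mg a).1 ha, (mg b).1 hb]; exact hab) with h | h
      · right; dsimp; rw [add_comm]; exact h
      · left; exact h
  choose inv hinvm hinv' using hinv
  have hmulg : ∀ (a : R), ∀ b ∈ ghost R, a * b ∈ ghost R := by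
    intro a b hb
    rw [mg, mul_left_comm, (mg b).1 hb]
  have h0g : (0 : R) ∈ ghost R := by rw [mg, mul_zero]
  have heg : (1 : R) + 1 ∈ ghost R := by rw [mg, ee_eq hs]
  let I : LinearOrderedCommGroupWithZero Γ :=
    { le := fun a b => a.1 + b.1 = b.1
      le_refl := fun a => hidem a.1 a.2
      le_trans := fun a b c (hab : a.1 + b.1 = b.1) (hbc : b.1 + c.1 = c.1) => by
        change a.1 + c.1 = c.1
        rw [← hbc, ← add_assoc, hab]
      le_antisymm := fun a b (hab : a.1 + b.1 = b.1) (hba : b.1 + a.1 = a.1) => by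
        apply Subtype.ext; rw [← hba, add_comm, hab]
      le_total := tot
      toDecidableLE := Classical.decRel _
      mul := fun a b => ⟨a.1 * b.1, hmulg _ _ b.2⟩
      one := ⟨1 + 1, heg⟩
      zero := ⟨0, h0g⟩
      mul_assoc := fun a b c => Subtype.ext (mul_assoc _ _ _)
      mul_comm := fun a b => Subtype.ext (mul_comm _ _)
      one_mul := fun a => Subtype.ext ((mg a.1).1 a.2)
      mul_one := fun a => Subtype.ext ((mul_comm _ _).trans ((mg a.1).1 a.2))
      zero_mul := fun a => Subtype.ext (zero_mul _)
      mul_zero := fun a => Subtype.ext (mul_zero _)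
      isBot_zero := fun a => zero_add a.1
      bot := ⟨0, h0g⟩
      bot_le := fun a => zero_add a.1
      mul_lt_mul_of_pos_left := by
        intro a ha b c hbc
        have ha0 : a.1 ≠ 0 := fun h => ha.2 (by
          change a.1 + 0 = 0
          rw [h, add_zero])
        have hbc1 : b.1 + c.1 = c.1 := hbc.1
        have hbc2 : ¬ (c.1 + b.1 = b.1) := hbc.2
        have hi : ∀ x ∈ ghost R, inv a.1 a.2 ha0 * (a.1 * x) = x := by
          intro x hx
          rw [← mul_assoc, mul_comm (inv _ _ _), hinv', (mg x).1 hx]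
        refine ⟨?_, fun h => hbc2 ?_⟩
        · change a.1 * b.1 + a.1 * c.1 = a.1 * c.1
          rw [← mul_add, hbc1]
        · have h : a.1 * c.1 + a.1 * b.1 = a.1 * b.1 := h
          have h2 := congrArg (fun z => inv a.1 a.2 ha0 * z) h
          simp only [mul_add] at h2
          rwa [hi _ b.2, hi _ c.2] at h2
      inv := fun a => if h : a.1 = 0 then ⟨0, h0g⟩ else ⟨inv a.1 a.2 h, hinvm a.1 a.2 h⟩
      inv_zero := dif_pos rfl
      mul_inv_cancel := fun a ha => by
        have h : a.1 ≠ 0 := fun h => ha (Subtype.ext h)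
        have : (if h : a.1 = 0 then (⟨0, h0g⟩ : Γ) else ⟨inv a.1 a.2 h, hinvm a.1 a.2 h⟩) = ⟨inv a.1 a.2 h, hinvm a.1 a.2 h⟩ := dif_neg h
        apply Subtype.ext
        change a.1 * (if h : a.1 = 0 then (⟨0, h0g⟩ : Γ) else ⟨inv a.1 a.2 h, hinvm a.1 a.2 h⟩).1 = 1 + 1
        rw [this]
        exact hinv' _ _ _
      exists_pair_ne := ⟨⟨0, h0g⟩, ⟨1 + 1, heg⟩, fun h => he0 (congrArg Subtype.val h).symm⟩ }
  refine ⟨Γ, I, ⟨{ ν := fun x => ⟨(1 + 1) * x, ⟨x, rfl⟩⟩, map_mul := ?_, map_one := ?_, map_zero := ?_, eq_zero := ?_, eq_iff := ?_, le_iff := ?_, surj := ?_, nontriv := ?_ }⟩⟩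
  · intro x y
    apply Subtype.ext
    change (1 + 1) * (x * y) = ((1 + 1) * x) * ((1 + 1) * y)
    rw [mul_mul_mul_comm, ee_eq hs]
  · apply Subtype.ext
    exact mul_one _
  · apply Subtype.ext
    exact mul_zero _
  · intro x hx
    have h : (1 + 1) * x = (1 + 1) * 0 := by
      rw [mul_zero]; exact congrArg Subtype.val hx
    have := hadd' x 0 h
    simpa using this
  · intro x y
    exact Subtype.ext_iff
  · intro x y
    exact Iff.rfl
  · rintro ⟨g, hg⟩ h
    obtain ⟨t, ht, hte⟩ := htan g hg (fun h0 => h (Subtype.ext h0))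
    exact ⟨t, hu t ht, ht, Subtype.ext hte⟩
  · exact ⟨⟨g0, hg0⟩, fun h => hg00 (congrArg Subtype.val h), fun h => hg01 (congrArg Subtype.val h)⟩

section Main

variable {R Γ : Type*} [CommSemiring R] [LinearOrderedCommGroupWithZero Γ]

theorem SVal.add_lt (hs : IsSupertropical R) (v : SVal R Γ) {x y : R} (h : v.ν x < v.ν y) :
    x + y = y := by
  have h1 := (v.le_iff x y).1 h.le
  have h2 : ((1 : R) + 1) * x ≠ ((1 : R) + 1) * y := fun h' => h.ne ((v.eq_iff x y).2 h')
  rcases hs.2.1 x y h2 with h3 | h3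
  · exfalso
    apply h2
    rw [← mul_add, h3] at h1
    exact h1
  · exact h3

theorem SVal.add_gt (hs : IsSupertropical R) (v : SVal R Γ) {x y : R} (h : v.ν y < v.ν x) :
    x + y = x := by
  rw [add_comm]; exact v.add_lt hs h

theorem SVal.add_eq (hs : IsSupertropical R) (v : SVal R Γ) {x y : R} (h : v.ν x = v.ν y) :
    x + y = ((1 : R) + 1) * x := by
  rw [hs.2.2 x y ((v.eq_iff x y).1 h), (v.eq_iff x y).1 h]

theorem SVal.map_e (hs : IsSupertropical R) (v : SVal R Γ) (x : R) :
    v.ν (((1 : R) + 1) * x) = v.ν x := by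
  rw [v.eq_iff, e_idem hs]

theorem SVal.map_add (hs : IsSupertropical R) (v : SVal R Γ) (x y : R) :
    v.ν (x + y) = max (v.ν x) (v.ν y) := by
  rcases lt_trichotomy (v.ν x) (v.ν y) with h | h | h
  · rw [v.add_lt hs h, max_eq_right h.le]
  · rw [v.add_eq hs h, v.map_e hs, max_eq_left h.ge]
  · rw [v.add_gt hs h, max_eq_left h.le]

theorem SVal.absorb (hs : IsSupertropical R) (v : SVal R Γ) {u y z : R} (h : v.ν y ≤ v.ν u)
    (hz : v.ν z = v.ν y ∨ (v.ν z ≤ v.ν y ∧ u ∈ ghost R)) : u + y = u + z := by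
  rcases hz with hz | ⟨hz, hg⟩
  · rcases h.lt_or_eq with h | h
    · rw [v.add_gt hs h, v.add_gt hs (hz.trans_lt h)]
    · rw [v.add_eq hs h.symm, v.add_eq hs (hz.trans h).symm]
  · have key : ∀ w, v.ν w ≤ v.ν u → u + w = u := by
      intro w hw
      rcases hw.lt_or_eq with h | h
      · exact v.add_gt hs h
      · rw [v.add_eq hs h.symm]; exact (mem_ghost_iff hs u).1 hg
    rw [key y h, key z (hz.trans h)]

theorem mem_comp_iff (α₁ α₂ α : R) (q : R × R → R)
    (hq : ∀ x : R × R, q x = α₁ * x.1 ^ 2 + α₂ * x.2 ^ 2 + α * (x.1 * x.2)) (β : R) :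
    β ∈ companionSet q ((1 : R), (0 : R)) ((0 : R), (1 : R)) ↔
      ∀ a c : R, α₁ * a ^ 2 + α₂ * c ^ 2 + α * (a * c) = α₁ * a ^ 2 + α₂ * c ^ 2 + β * (a * c) := by
  constructor
  · rintro ⟨b, ⟨hsym, hsm, -⟩, hacc, rfl⟩ a c
    have h := hacc a c
    unfold Accomp at h
    rw [hsm, hsym, hsm, hsym, hq, hq, hq] at h
    simp at h
    rw [h]; ring
  · intro h
    refine ⟨fun x y => β * (x.1 * y.2 + x.2 * y.1), ⟨?_, ?_, ?_⟩, ?_, ?_⟩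
    · intro x y; ring
    · intro a x y; simp; ring
    · intro x x' y; simp; ring
    · intro a c
      unfold Accomp
      rw [hq, hq, hq]
      simpa using h a c
    · simp

theorem mem_unique (hs : IsSupertropical R) (v : SVal R Γ) {α₁ α₂ α β : R}
    (h : ∀ a c : R, α₁ * a ^ 2 + α₂ * c ^ 2 + α * (a * c) = α₁ * a ^ 2 + α₂ * c ^ 2 + β * (a * c))
    {γ : Γ} (hγ : γ ≠ 0) (h1 : v.ν α₁ * γ < v.ν α) (h2 : v.ν α₂ < v.ν α * γ) : β = α := by
  obtain ⟨t, htu, -, rfl⟩ := v.surj γ hγ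
  have hp : 0 < v.ν t := zero_lt_iff.2 hγ
  have h := h t 1
  simp only [one_pow, mul_one] at h
  have hlt : v.ν (α₁ * t ^ 2 + α₂) < v.ν (α * t) := by
    rw [v.map_add hs, max_lt_iff, pow_two, v.map_mul, v.map_mul, v.map_mul, ← mul_assoc]
    exact ⟨mul_lt_mul_of_pos_right h1 hp, h2⟩
  rw [v.add_lt hs hlt] at h
  have h3 : v.ν (α * t) = v.ν (β * t) := by
    have h4 := congrArg v.ν h
    rw [v.map_add hs] at h4
    rcases max_choice (v.ν (α₁ * t ^ 2 + α₂)) (v.ν (β * t)) with h5 | h5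
    · rw [h5] at h4; exact absurd h4 hlt.ne'
    · rw [h5] at h4; exact h4
  rw [v.add_lt hs (h3 ▸ hlt)] at h
  exact (htu.mul_left_injective h).symm

theorem mem_bound (hs : IsSupertropical R) (v : SVal R Γ) {α₁ α₂ α β : R}
    (h : ∀ a c : R, α₁ * a ^ 2 + α₂ * c ^ 2 + α * (a * c) = α₁ * a ^ 2 + α₂ * c ^ 2 + β * (a * c))
    (hB : v.ν α₂ ≠ 0) (hlt : v.ν α₁ * v.ν α₂ < v.ν α * v.ν α) :
    v.ν β ≤ v.ν α ∧ (α₂ ∉ ghost R → v.ν β = v.ν α) := by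
  have hC : v.ν α ≠ 0 := by
    intro h; rw [h, mul_zero] at hlt; exact not_lt_zero hlt
  obtain ⟨t, htu, -, ht⟩ := v.surj (v.ν α₂ / v.ν α) (div_ne_zero hB hC)
  have hp : 0 < v.ν t := zero_lt_iff.2 (ht ▸ div_ne_zero hB hC)
  have hCt : v.ν α * v.ν t = v.ν α₂ := by rw [ht]; field_simp
  have h := h t 1
  simp only [one_pow, mul_one] at h
  have h1 : v.ν (α₁ * t ^ 2) < v.ν α₂ := by
    rw [pow_two, v.map_mul, v.map_mul]
    have hCp : 0 < v.ν α * v.ν α := zero_lt_iff.2 (mul_ne_zero hC hC)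
    refine lt_of_mul_lt_mul_right (a := v.ν α * v.ν α) ?_ hCp.le
    calc v.ν α₁ * (v.ν t * v.ν t) * (v.ν α * v.ν α)
        = v.ν α₁ * (v.ν α * v.ν t) * (v.ν α * v.ν t) := by ac_rfl
      _ = v.ν α₂ * (v.ν α₁ * v.ν α₂) := by rw [hCt]; ac_rfl
      _ < v.ν α₂ * (v.ν α * v.ν α) := mul_lt_mul_of_pos_left hlt (zero_lt_iff.2 hB)
  have h2 : v.ν α₂ = v.ν (α * t) := by rw [v.map_mul, hCt]
  rw [v.add_lt hs h1, v.add_eq hs h2] at h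
  have hle : v.ν β ≤ v.ν α := by
    by_contra hcon
    push Not at hcon
    have h3 : v.ν α₂ < v.ν (β * t) := by
      rw [h2, v.map_mul, v.map_mul]
      exact mul_lt_mul_of_pos_right hcon hp
    rw [v.add_lt hs h3] at h
    rw [← h, v.map_e hs] at h3
    exact lt_irrefl _ h3
  refine ⟨hle, fun hg => ?_⟩
  by_contra hne
  have h3 : v.ν (β * t) < v.ν α₂ := by
    rw [h2, v.map_mul, v.map_mul]
    exact mul_lt_mul_of_pos_right (lt_of_le_of_ne hle hne) hp
  rw [v.add_gt hs h3] at h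
  exact hg ((mem_ghost_iff hs α₂).2 h)

theorem mem_swap {α₁ α₂ α β : R}
    (h : ∀ a c : R, α₁ * a ^ 2 + α₂ * c ^ 2 + α * (a * c) = α₁ * a ^ 2 + α₂ * c ^ 2 + β * (a * c)) :
    ∀ a c : R, α₂ * a ^ 2 + α₁ * c ^ 2 + α * (a * c) = α₂ * a ^ 2 + α₁ * c ^ 2 + β * (a * c) := by
  intro a c
  have := h c a
  rw [add_comm (α₂ * a ^ 2), mul_comm a c]; exact this

theorem mem_of_exc (hs : IsSupertropical R) (v : SVal R Γ) {α₁ α₂ α β : R} {P : Γ}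
    (hP : ∀ γ : Γ, γ ≠ 0 → γ < 1 → γ ≤ P) (hPC : P * (v.ν α * v.ν α) = v.ν α₁ * v.ν α₂)
    (hA : v.ν α₁ ≠ 0) (hC : v.ν α ≠ 0)
    (hβ : v.ν β = v.ν α ∨ (v.ν β ≤ v.ν α ∧ α₁ ∈ ghost R ∧ α₂ ∈ ghost R)) (a c : R) :
    α₁ * a ^ 2 + α₂ * c ^ 2 + α * (a * c) = α₁ * a ^ 2 + α₂ * c ^ 2 + β * (a * c) := by
  by_cases ha : v.ν a = 0
  · rw [v.eq_zero a ha]; simp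
  by_cases hc : v.ν c = 0
  · rw [v.eq_zero c hc]; simp
  have hmg : ∀ x y : R, x ∈ ghost R → x * y ∈ ghost R := by
    rintro x y ⟨r, rfl⟩
    exact ⟨r * y, by dsimp; ring⟩
  have hpos : ∀ {x : Γ}, x ≠ 0 → 0 < x := fun h => zero_lt_iff.2 h
  have hle : v.ν β ≤ v.ν α := by
    rcases hβ with h | h
    · exact h.le
    · exact h.1
  have hz : ∀ u y : R, (α₁ ∈ ghost R ∧ α₂ ∈ ghost R → u ∈ ghost R) →
      v.ν (β * y) = v.ν (α * y) ∨ (v.ν (β * y) ≤ v.ν (α * y) ∧ u ∈ ghost R) := by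
    intro u y hu
    rcases hβ with h | h
    · left; rw [v.map_mul, v.map_mul, h]
    · right; refine ⟨?_, hu h.2⟩
      rw [v.map_mul, v.map_mul]
      exact mul_le_mul_left h.1 _
  have dich : v.ν α * v.ν a ≤ v.ν α₂ * v.ν c ∨ v.ν α * v.ν c ≤ v.ν α₁ * v.ν a := by
    by_contra! hcon
    obtain ⟨h1, h2⟩ := hcon
    have hCc := hpos (mul_ne_zero hC hc)
    have h3 := hP (v.ν α₁ * v.ν a / (v.ν α * v.ν c))
      (div_ne_zero (mul_ne_zero hA ha) (mul_ne_zero hC hc)) ((div_lt_one₀ hCc).2 h2)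
    rw [div_le_iff₀ hCc] at h3
    have h4 : v.ν α₁ * (v.ν α * v.ν a) ≤ v.ν α₁ * (v.ν α₂ * v.ν c) := by
      calc v.ν α₁ * (v.ν α * v.ν a) = (v.ν α₁ * v.ν a) * v.ν α := by ac_rfl
        _ ≤ P * (v.ν α * v.ν c) * v.ν α := mul_le_mul_of_nonneg_right h3 (hpos hC).le
        _ = P * (v.ν α * v.ν α) * v.ν c := by ac_rfl
        _ = _ := by rw [hPC]; ac_rfl
    exact absurd (le_of_mul_le_mul_left h4 (hpos hA)) (not_le.2 h1)
  rcases dich with h | h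
  · rw [add_assoc, add_assoc, v.absorb hs _ (hz (α₂ * c ^ 2) (a * c) (fun h => hmg _ _ h.2))]
    rw [pow_two, v.map_mul, v.map_mul, v.map_mul, v.map_mul, ← mul_assoc, ← mul_assoc]
    exact mul_le_mul_of_nonneg_right h (hpos hc).le
  · rw [add_comm (α₁ * a ^ 2), add_assoc, add_assoc,
      v.absorb hs _ (hz (α₁ * a ^ 2) (a * c) (fun h => hmg _ _ h.1))]
    rw [pow_two, v.map_mul, v.map_mul, v.map_mul, v.map_mul, ← mul_assoc, mul_right_comm, ← mul_assoc]
    exact mul_le_mul_of_nonneg_right h (hpos ha).le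

theorem gamma_or_prime (A B C : Γ) (h : A * B < C * C) (hnt : ∃ γ : Γ, γ ≠ 0 ∧ γ ≠ 1) :
    (∃ γ, γ ≠ 0 ∧ A * γ < C ∧ B < C * γ) ∨
    (∃ P : Γ, P ≠ 0 ∧ P < 1 ∧ (∀ γ, γ ≠ 0 → γ < 1 → γ ≤ P) ∧ P * (C * C) = A * B) := by
  have hC : C ≠ 0 := by
    intro h0; rw [h0, mul_zero] at h; exact not_lt_zero h
  have hpos : ∀ {x : Γ}, x ≠ 0 → 0 < x := fun h => zero_lt_iff.2 h
  obtain ⟨δ, hδ0, hδ⟩ : ∃ δ : Γ, δ ≠ 0 ∧ 1 < δ := by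
    obtain ⟨γ, h0, h1⟩ := hnt
    rcases lt_or_gt_of_ne h1 with h1 | h1
    · exact ⟨γ⁻¹, inv_ne_zero h0, (one_lt_inv₀ (hpos h0)).2 h1⟩
    · exact ⟨γ, h0, h1⟩
  by_cases hB : B = 0
  · left
    by_cases hA : A = 0
    · exact ⟨1, one_ne_zero, by rw [hA, zero_mul]; exact hpos hC, by rw [hB, mul_one]; exact hpos hC⟩
    · refine ⟨C / A * δ⁻¹, by simp [*], ?_, ?_⟩
      · have : A * (C / A * δ⁻¹) = C / δ := by field_simp
        rw [this, div_lt_iff₀ (hpos hδ0)]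
        exact lt_mul_of_one_lt_right (hpos hC) hδ
      · rw [hB]; apply hpos; simp [*]
  by_cases hA : A = 0
  · left
    refine ⟨B / C * δ, by simp [*], by rw [hA, zero_mul]; exact hpos hC, ?_⟩
    have : C * (B / C * δ) = B * δ := by field_simp
    rw [this]
    exact lt_mul_of_one_lt_right (hpos hB) hδ
  by_cases hex : ∃ γ, γ ≠ 0 ∧ A * γ < C ∧ B < C * γ
  · exact Or.inl hex
  right
  have hCC := hpos (mul_ne_zero hC hC)
  refine ⟨A * B / (C * C), by simp [*], (div_lt_one₀ hCC).2 h, ?_, by field_simp⟩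
  intro γ hγ hγ1
  by_contra! hcon
  apply hex
  refine ⟨γ * C / A, by simp [*], ?_, ?_⟩
  · have : A * (γ * C / A) = γ * C := by field_simp
    rw [this]
    exact mul_lt_of_lt_one_left (hpos hC) hγ1
  · rw [div_lt_iff₀ hCC] at hcon
    rw [← mul_div_assoc, lt_div_iff₀ (hpos hA)]
    calc B * A = A * B := mul_comm _ _
      _ < _ := hcon
      _ = _ := by ac_rfl

theorem prime_of_val (hs : IsSupertropical R) (v : SVal R Γ) {P : Γ} (hP0 : P ≠ 0) (hP1 : P < 1)
    (hP : ∀ γ : Γ, γ ≠ 0 → γ < 1 → γ ≤ P) :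
    DiscreteR R ∧ ∃ p : R, IsPrimeElem p ∧ v.ν p = P := by
  obtain ⟨p, hpu, hpg, rfl⟩ := v.surj P hP0
  have hpos : ∀ {x : Γ}, x ≠ 0 → 0 < x := fun h => zero_lt_iff.2 h
  have mg := mem_ghost_iff hs
  constructor
  · intro x hx hx0
    have hνx : v.ν x ≠ 0 := fun h => hx0 (v.eq_zero x h)
    have hpx : v.ν (((1 : R) + 1) * (p * x)) = v.ν p * v.ν x := by rw [v.map_e hs, v.map_mul]
    refine ⟨((1 : R) + 1) * (p * x), ⟨_, rfl⟩, ?_, ⟨?_, ?_⟩, ?_⟩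
    · intro h
      rw [h, v.map_zero] at hpx
      exact mul_ne_zero hP0 hνx hpx.symm
    · apply v.add_lt hs
      rw [hpx]
      exact mul_lt_of_lt_one_left (hpos hνx) hP1
    · intro h
      rw [h] at hpx
      exact (mul_lt_of_lt_one_left (hpos hνx) hP1).ne hpx.symm
    · rintro y hy hy0 ⟨hyx, hyx'⟩
      have hνy : v.ν y ≠ 0 := fun h => hy0 (v.eq_zero y h)
      have hlt : v.ν y < v.ν x := by
        refine lt_of_le_of_ne ?_ ?_
        · rw [v.le_iff, (mg _).1 hy, (mg _).1 hx]; exact hyx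
        · rw [Ne, v.eq_iff, (mg _).1 hy, (mg _).1 hx]; exact hyx'
      have h1 := hP (v.ν y / v.ν x) (div_ne_zero hνy hνx) ((div_lt_one₀ (hpos hνx)).2 hlt)
      rw [div_le_iff₀ (hpos hνx), ← v.map_mul, v.le_iff, (mg _).1 hy] at h1
      exact h1
  · refine ⟨p, ⟨hpg, ⟨?_, ?_⟩, ?_⟩, rfl⟩
    · have := (v.le_iff p 1).1 (by rw [v.map_one]; exact hP1.le)
      rwa [mul_one] at this
    · intro h
      have := (v.eq_iff p 1).2 (by rw [mul_one]; exact h)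
      rw [v.map_one] at this
      exact hP1.ne this
    · rintro y hy hy0 ⟨hy1, hy1'⟩
      have hνy : v.ν y ≠ 0 := fun h => hy0 (v.eq_zero y h)
      have hlt : v.ν y < 1 := by
        rw [← v.map_one]
        refine lt_of_le_of_ne ?_ ?_
        · rw [v.le_iff, (mg _).1 hy, mul_one]; exact hy1
        · rw [Ne, v.eq_iff, (mg _).1 hy, mul_one]; exact hy1'
      have h1 := hP (v.ν y) hνy hlt
      rw [v.le_iff, (mg _).1 hy] at h1
      exact h1

theorem val_of_prime (hs : IsSupertropical R) (v : SVal R Γ) {p : R} (hp : IsPrimeElem p) :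
    ∀ γ : Γ, γ ≠ 0 → γ < 1 → γ ≤ v.ν p := by
  intro γ h0 h1
  obtain ⟨t, -, -, rfl⟩ := v.surj γ h0
  rw [v.le_iff]
  refine hp.2.2 (((1 : R) + 1) * t) ⟨t, rfl⟩ ?_ ⟨?_, ?_⟩
  · intro h
    apply h0
    rw [← v.map_e hs, h, v.map_zero]
  · have := (v.le_iff t 1).1 (by rw [v.map_one]; exact h1.le)
    rwa [mul_one] at this
  · intro h
    have := (v.eq_iff t 1).2 (by rw [mul_one]; exact h)
    rw [v.map_one] at this
    exact h1.ne this

theorem mle_iff_val (hs : IsSupertropical R) (v : SVal R Γ) (α β : R) :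
    mle β (((1 : R) + 1) * α) ↔ v.ν β ≤ v.ν α := by
  constructor
  · rintro ⟨z, hz⟩
    rw [← v.map_e hs α, ← hz, v.map_add hs]
    exact le_max_left _ _
  · intro h
    refine ⟨((1 : R) + 1) * α, ?_⟩
    rcases h.lt_or_eq with h | h
    · exact v.add_lt hs (by rw [v.map_e hs]; exact h)
    · rw [v.add_eq hs (by rw [v.map_e hs]; exact h)]; exact (v.eq_iff _ _).1 h

end Main

/-- For `q = [α₁, α; α₂]` on `R² = Rε₁ ⊕ Rε₂` over a nontrivial tangible
supersemifield with `α₁α₂ <_ν α²`, one has `C_{1,2}(q) = {α}`, except when `R` is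
discrete, `α₁α₂` is not a ν-square, and `α² ≅_ν π⁻¹α₁α₂` (i.e. `πα² ≅_ν α₁α₂`);
in that case `C_{1,2}(q) = [0, eα]` if `α₁, α₂` are ghost, and
`C_{1,2}(q) = {β | β ≅_ν α}` if `α₁` or `α₂` is tangible. -/
theorem stmt_15 {R : Type*} [CommSemiring R] (hR : IsNTSupersemifield R)
    (α₁ α₂ α : R) (hlt : nult (α₁ * α₂) (α ^ 2))
    (q : R × R → R)
    (hq : ∀ x : R × R, q x = α₁ * x.1 ^ 2 + α₂ * x.2 ^ 2 + α * (x.1 * x.2)) :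
    ((¬ DiscreteR R ∨ IsNuSquare (α₁ * α₂) ∨
        ∀ p : R, IsPrimeElem p → ¬ nueq (p * α ^ 2) (α₁ * α₂)) →
      companionSet q ((1 : R), (0 : R)) ((0 : R), (1 : R)) = {α}) ∧
    (∀ p : R, IsPrimeElem p → DiscreteR R → ¬ IsNuSquare (α₁ * α₂) →
      nueq (p * α ^ 2) (α₁ * α₂) →
      ((α₁ ∈ ghost R ∧ α₂ ∈ ghost R →
          companionSet q ((1 : R), (0 : R)) ((0 : R), (1 : R)) =
            {β : R | mle β (((1 : R) + 1) * α)}) ∧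
       ((α₁ ∉ ghost R ∨ α₂ ∉ ghost R) →
          companionSet q ((1 : R), (0 : R)) ((0 : R), (1 : R)) =
            {β : R | nueq β α}))) := by
  obtain ⟨Γ, _, ⟨v⟩⟩ := exists_SVal hR
  have hs := hR.1
  have hlt' : v.ν α₁ * v.ν α₂ < v.ν α * v.ν α := by
    rw [← v.map_mul, ← v.map_mul, ← pow_two]
    exact lt_of_le_of_ne ((v.le_iff _ _).2 hlt.1) (fun h => hlt.2 ((v.eq_iff _ _).1 h))
  have hC : v.ν α ≠ 0 := by
    intro h; rw [h, mul_zero] at hlt'; exact not_lt_zero hlt'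
  refine ⟨fun hne => ?_, fun p hp _ hnsq hpα => ?_⟩
  · ext β
    rw [mem_comp_iff α₁ α₂ α q hq, Set.mem_singleton_iff]
    constructor
    · intro h
      rcases gamma_or_prime _ _ _ hlt' v.nontriv with ⟨γ, h0, h1, h2⟩ | ⟨P, h0, h1, h2, h3⟩
      · exact mem_unique hs v h h0 h1 h2
      · exfalso
        obtain ⟨hd, p, hp, hpP⟩ := prime_of_val hs v h0 h1 h2
        rcases hne with hne | ⟨b, hb⟩ | hne
        · exact hne hd
        · have hb' := (v.eq_iff _ _).2 hb
          rw [v.map_mul, pow_two, v.map_mul, ← h3] at hb'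
          have hPs : P = (v.ν b / v.ν α) * (v.ν b / v.ν α) := by
            rw [div_mul_div_comm, ← hb']; field_simp
          have hs0 : v.ν b / v.ν α ≠ 0 := by
            intro h; rw [h, mul_zero] at hPs; exact h0 hPs
          have hs1 : v.ν b / v.ν α < 1 := by
            by_contra! hcon
            rw [hPs] at h1
            exact absurd (one_le_mul hcon hcon) (not_le.2 h1)
          have hle := h2 _ hs0 hs1
          rw [hPs] at hle
          exact absurd (mul_lt_of_lt_one_left (zero_lt_iff.2 hs0) hs1) (not_lt.2 hle)
        · apply hne p hp
          apply (v.eq_iff _ _).1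
          rw [v.map_mul, pow_two, v.map_mul, v.map_mul, hpP, h3]
    · rintro rfl a c
      rfl
  · have hAB : v.ν α₁ * v.ν α₂ ≠ 0 := by
      intro h
      rw [← v.map_mul] at h
      apply hnsq
      exact ⟨0, by rw [v.eq_zero _ h]; simp⟩
    have hA := left_ne_zero_of_mul hAB
    have hB := right_ne_zero_of_mul hAB
    have hP := val_of_prime hs v hp
    have hPC : v.ν p * (v.ν α * v.ν α) = v.ν α₁ * v.ν α₂ := by
      have := (v.eq_iff _ _).2 hpα
      rwa [v.map_mul, pow_two, v.map_mul, v.map_mul] at this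
    refine ⟨fun hg => ?_, fun hg => ?_⟩
    · ext β
      rw [mem_comp_iff α₁ α₂ α q hq, Set.mem_ofPred_eq, mle_iff_val hs v]
      exact ⟨fun h => (mem_bound hs v h hB hlt').1,
        fun h => mem_of_exc hs v hP hPC hA hC (Or.inr ⟨h, hg⟩)⟩
    · ext β
      rw [mem_comp_iff α₁ α₂ α q hq, Set.mem_ofPred_eq, nueq, ← v.eq_iff]
      refine ⟨fun h => ?_, fun h => mem_of_exc hs v hP hPC hA hC (Or.inl h)⟩
      rcases hg with hg | hg
      · exact (mem_bound hs v (mem_swap h) hA (by rwa [mul_comm])).2 hg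
      · exact (mem_bound hs v h hB hlt').2 hg
end

section
/- Let R be a nontrivial tangible supersemifield and let q be the quadratic form on the free module V = Rε₁ ⊕ Rε₂ given by q(x₁ε₁ + x₂ε₂) = α₁x₁² + α₂x₂² + αx₁x₂, where α₁, α₂, α ∈ R satisfy α² ≤_ν α₁α₂. Then C_{1,2}(q) = {β ∈ R | β² ≤_ν α₁α₂}, except in the case that R is discrete, α₁α₂ is not a ν-square, and both α₁ ∈ eR and α₂ ∈ eR; in that exceptional case C_{1,2}(q) = {β ∈ R | β² ≤_ν π⁻¹α₁α₂} for a prime element π of R. -/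
namespace ST
variable {R : Type*} [CommSemiring R]

lemma ee (h : IsSupertropical R) : ((1:R)+1)*((1:R)+1) = (1:R)+1 := by
  rw [mul_add, mul_one]; exact h.1

lemma ee' (h : IsSupertropical R) (x : R) : ((1:R)+1)*(((1:R)+1)*x) = ((1:R)+1)*x := by
  rw [← mul_assoc, ee h]

lemma gh (h : IsSupertropical R) {x : R} (hx : x ∈ ghost R) : ((1:R)+1)*x = x := by
  obtain ⟨r, rfl⟩ := hx; exact ee' h r

lemma le_of_nueq (h : IsSupertropical R) {a b : R} (H : nueq a b) : nule a b := by
  unfold nueq at H; unfold nule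
  rw [h.2.2 (((1:R)+1)*a) (((1:R)+1)*b) (by rw [H]), ee' h]

lemma le_rfl' (h : IsSupertropical R) (a : R) : nule a a := le_of_nueq h rfl

lemma total (h : IsSupertropical R) (a b : R) : nule a b ∨ nule b a := by
  by_cases H : nueq a b
  · exact Or.inl (le_of_nueq h H)
  · unfold nule
    rcases h.2.1 (((1:R)+1)*a) (((1:R)+1)*b) (by rwa [ee' h, ee' h]) with h1 | h1
    · right; rw [add_comm]; exact h1
    · left; exact h1

lemma trans' {a b c : R} (h1 : nule a b) (h2 : nule b c) : nule a c := by
  unfold nule at *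
  rw [← h2, ← add_assoc, h1]

lemma antisymm' {a b : R} (h1 : nule a b) (h2 : nule b a) : nueq a b := by
  unfold nule at *; unfold nueq
  rw [add_comm, h1] at h2; exact h2.symm

lemma mulmono {a b : R} (c : R) (h1 : nule a b) : nule (c*a) (c*b) := by
  unfold nule at *
  rw [mul_left_comm, mul_left_comm _ c b, ← mul_add, h1]

lemma nueq_mul {a b : R} (c : R) (h1 : nueq a b) : nueq (c*a) (c*b) := by
  unfold nueq at *
  rw [mul_left_comm, mul_left_comm _ c b, h1]

lemma zero_le' (a : R) : nule 0 a := by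
  unfold nule; simp

lemma eq_zero (h : IsSupertropical R) {x : R} (H : ((1:R)+1)*x = 0) : x = 0 := by
  have := h.2.2 x 0 (by rw [H, mul_zero])
  simpa using this

lemma eq_zero_of_le (h : IsSupertropical R) {x : R} (H : nule x 0) : x = 0 := by
  unfold nule at H; apply eq_zero h; simpa using H

lemma inv (hR : IsNTSupersemifield R) {x : R} (hx : x ≠ 0) :
    ∃ y, y ∉ ghost R ∧ nueq (x*y) 1 := by
  obtain ⟨h, -, h3, h4, -⟩ := hR
  obtain ⟨g, hg, hxg⟩ := h3 (((1:R)+1)*x) ⟨x, rfl⟩ (fun H => hx (eq_zero h H))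
  have he : (1:R)+1 ≠ 0 := fun H => hx (eq_zero h (by rw [H, zero_mul]))
  obtain ⟨t, ht, hte⟩ := h4 g hg (by rintro rfl; exact he (by rw [← hxg, mul_zero]))
  refine ⟨t, ht, ?_⟩
  unfold nueq
  rw [← hte] at hxg
  calc _ = ((1+1)*(1+1))*(x*t) := by rw [ee h]
    _ = (1+1)*x*((1+1)*t) := by ring
    _ = _ := by rw [hxg, mul_one]

lemma cancel (hR : IsNTSupersemifield R) {a b c : R} (hc : c ≠ 0) (H : nule (c*a) (c*b)) :
    nule a b := by
  obtain ⟨y, -, hy⟩ := inv hR hc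
  have h := hR.1
  have key : ∀ a : R, nueq (y*(c*a)) a := fun a => by
    have := nueq_mul a hy
    rw [mul_one] at this
    rwa [show y*(c*a) = a*(c*y) by ring]
  exact trans' (le_of_nueq h (key a).symm) (trans' (mulmono y H) (le_of_nueq h (key b)))

lemma ltmul (hR : IsNTSupersemifield R) {a b c : R} (hc : c ≠ 0) (H : ¬ nule a b) :
    ¬ nule (c*a) (c*b) := fun h => H (cancel hR hc h)

lemma ne_of_lt {a b : R} (H : ¬ nule a b) : a ≠ 0 := by
  rintro rfl; exact H (zero_le' b)

lemma mul_ne (hR : IsNTSupersemifield R) {a b : R} (ha : a ≠ 0) (hb : b ≠ 0) : a*b ≠ 0 := by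
  intro H
  apply hb
  apply eq_zero_of_le hR.1
  apply cancel hR ha
  rw [H, mul_zero]; exact zero_le' 0

/-- strictly smaller summand is absorbed -/
lemma add_lt (h : IsSupertropical R) {a b : R} (H : ¬ nule b a) : a + b = b := by
  rcases h.2.1 a b (fun H' => H (le_of_nueq h H'.symm)) with h1 | h1
  · exact absurd (by unfold nule; rw [← mul_add, add_comm b a, h1]) H
  · exact h1

lemma add_ghost (h : IsSupertropical R) {a b : R} (H : nule a b) (hb : b ∈ ghost R) :
    b + a = b := by
  by_cases H' : nule b a
  · rw [add_comm, h.2.2 a b (antisymm' H H'), gh h hb]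
  · rw [add_comm, add_lt h H']

lemma le_of_sq (hR : IsNTSupersemifield R) {a b : R} (H : nule (a^2) (b^2)) : nule a b := by
  by_contra h1
  have h2 := (total hR.1 a b).resolve_left h1
  rw [pow_two, pow_two] at H
  have h3 := mulmono b h2
  rw [mul_comm b a] at h3
  exact h1 (cancel hR (ne_of_lt h1) (trans' H h3))

lemma absorb (hR : IsNTSupersemifield R) {x y z : R} (H : nule (z^2) (x*y)) :
    x + y + z = x + y := by
  have h := hR.1
  have main : ∀ x y : R, nule (z^2) (x*y) → ¬ nule x y → x + y + z = x + y := by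
    intro x y H h1
    rw [add_comm x y, add_lt h h1, add_comm]
    apply add_lt h
    intro h2
    apply h1
    apply cancel hR (ne_of_lt h1)
    refine trans' ?_ H
    have := mulmono x h2
    refine trans' this ?_
    have := mulmono z h2
    rwa [mul_comm z x, ← pow_two] at this
  by_cases h1 : nule x y
  · by_cases h2 : nule y x
    · rw [h.2.2 x y (antisymm' h1 h2)]
      apply add_ghost h _ ⟨y, rfl⟩
      refine trans' (b := y) (le_of_sq hR ?_) (le_of_nueq h (ee' h y).symm)
      refine trans' H ?_
      have := mulmono y h1
      rwa [mul_comm y x, ← pow_two] at this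
    · have := main y x (by rwa [mul_comm]) h2
      rwa [add_comm y x] at this
  · exact main x y H h1

lemma le_add (h : IsSupertropical R) {x y z : R} (H : nule z (x + y)) :
    nule z x ∨ nule z y := by
  unfold nule at H
  rw [mul_add] at H
  rcases total h x y with h1 | h1
  · right; unfold nule at *; rwa [h1] at H
  · left; unfold nule at *; rw [add_comm (_ * x), h1] at H; exact H

lemma mem_iff (hR : IsNTSupersemifield R)
    (α₁ α₂ α : R) (hle : nule (α ^ 2) (α₁ * α₂))
    (q : R × R → R)
    (hq : ∀ x : R × R, q x = α₁ * x.1 ^ 2 + α₂ * x.2 ^ 2 + α * (x.1 * x.2)) (β : R) :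
    β ∈ companionSet q ((1 : R), (0 : R)) ((0 : R), (1 : R)) ↔
      ∀ a c : R, α₁*a^2 + α₂*c^2 + β*(a*c) = α₁*a^2 + α₂*c^2 := by
  have key : ∀ a c : R, α₁*a^2 + α₂*c^2 + α*(a*c) = α₁*a^2 + α₂*c^2 := by
    intro a c
    apply absorb hR
    have := mulmono ((a*c)^2) hle
    convert this using 1 <;> ring
  constructor
  · rintro ⟨b, ⟨hs, hm, -⟩, hb, rfl⟩ a c
    have h1 := hb a c
    unfold Accomp at h1
    rw [hm, hs, hm, hs, hq, hq, hq] at h1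
    simp at h1
    rw [key] at h1
    refine Eq.trans ?_ h1.symm
    ring
  · intro H
    refine ⟨fun x y => β*(x.1*y.2 + x.2*y.1), ⟨?_, ?_, ?_⟩, ?_, ?_⟩
    · intro x y; ring
    · intro a x y; simp; ring
    · intro x x' y; simp; ring
    · intro a c
      unfold Accomp
      rw [hq, hq, hq]
      simp
      rw [key, H]
    · simp

lemma le_mem (hR : IsNTSupersemifield R) {α₁ α₂ β : R} (hle : nule (β ^ 2) (α₁ * α₂)) (a c : R) :
    α₁*a^2 + α₂*c^2 + β*(a*c) = α₁*a^2 + α₂*c^2 := by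
  apply absorb hR
  have := mulmono ((a*c)^2) hle
  convert this using 1 <;> ring

/-- violation -/
lemma viol (hR : IsNTSupersemifield R) {α₁ α₂ β : R}
    (H : ∀ a c : R, α₁*a^2 + α₂*c^2 + β*(a*c) = α₁*a^2 + α₂*c^2) {a c : R}
    (ha : a ≠ 0) (hc : c ≠ 0) (h1 : ¬ nule (β*c) (α₁*a)) (h2 : ¬ nule (β*a) (α₂*c)) : False := by
  have h3 := ltmul hR ha h1
  have h4 := ltmul hR hc h2
  have h5 : nule (β*(a*c)) (α₁*a^2 + α₂*c^2) := by
    have := congrArg (fun t => ((1:R)+1)*t) (H a c)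
    simp only [mul_add (1+1 : R) (α₁*a^2 + α₂*c^2)] at this
    unfold nule; rw [add_comm]; exact this
  rcases le_add hR.1 h5 with h | h
  · apply h3; convert h using 1 <;> ring
  · apply h4; convert h using 1 <;> ring

lemma tang_mul (hR : IsNTSupersemifield R) {a b : R} (ha : a ∉ ghost R) (hb : b ∉ ghost R) :
    a*b ∉ ghost R := by
  rintro ⟨r, hr⟩
  obtain ⟨u, rfl⟩ := hR.2.1 b hb
  apply ha
  refine ⟨r * (↑u⁻¹ : R), ?_⟩
  simp only at hr ⊢
  rw [← mul_assoc, hr, mul_assoc, Units.mul_inv, mul_one]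

lemma tang_ne {a : R} (ha : a ∉ ghost R) : a ≠ 0 := by
  rintro rfl; exact ha ⟨0, by simp⟩

lemma tang (hR : IsNTSupersemifield R) {α₁ α₂ β : R}
    (H : ∀ a c : R, α₁*a^2 + α₂*c^2 + β*(a*c) = α₁*a^2 + α₂*c^2) (h1 : α₁ ∉ ghost R) :
    nule (β^2) (α₁*α₂) := by
  by_contra hc
  have h := hR.1
  have hb : β ≠ 0 := by rintro rfl; apply hc; simpa using zero_le' _
  obtain ⟨i, hi, hi'⟩ := inv hR (tang_ne h1)
  obtain ⟨t, ht, hte⟩ := hR.2.2.2.1 (((1:R)+1)*β) ⟨β, rfl⟩ (fun H => hb (eq_zero h H))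
  have e1 : nueq (α₁*(i*t)^2) (β*((i*t)*1)) := by
    have a1 := nueq_mul (i*t*t) hi'
    have a2 := nueq_mul (i*t) hte
    unfold nueq at *
    calc _ = (1+1)*(i*t*t*(α₁*i)) := by ring
      _ = (1+1)*(i*t*t*1) := a1
      _ = (1+1)*(i*t*β) := by rw [mul_one]; exact a2
      _ = _ := by ring
  have e2 : ¬ nule (β*((i*t)*1)) (α₂*1^2) := by
    have a3 := ltmul hR (tang_ne hi) hc
    intro h4
    apply a3
    have a4 : nueq (β^2*i) (β*(i*t*1)) := by
      have := nueq_mul (β*i) hte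
      unfold nueq at *
      calc _ = (1+1)*(β*i*β) := by ring
        _ = _ := this.symm
        _ = _ := by ring_nf
    have a5 : nueq (α₂*1^2) (i*(α₁*α₂)) := by
      have := nueq_mul α₂ hi'
      unfold nueq at *
      calc _ = (1+1)*(α₂*1) := by ring
        _ = _ := this.symm
        _ = _ := by ring_nf
    rw [mul_comm]
    exact trans' (le_of_nueq h a4) (trans' h4 (le_of_nueq h a5))
  have e3 : ¬ nule (α₁*(i*t)^2) (α₂*1^2) := fun h6 => e2 (trans' (le_of_nueq h e1.symm) h6)
  have := H (i*t) 1
  rw [add_comm (α₁*(i*t)^2), add_lt h e3, h.2.2 _ _ e1] at this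
  have htt : α₁*(i*t)^2 ∉ ghost R := by
    rw [pow_two]
    have := tang_mul hR hi ht
    exact tang_mul hR h1 (tang_mul hR this this)
  exact htt ⟨_, this⟩

lemma exists_gt (hR : IsNTSupersemifield R) (x : R) : ∃ s, ¬ nule s x := by
  obtain ⟨g, hg, hg0, hg1⟩ := hR.2.2.2.2
  have h := hR.1
  have h1 : ∃ t : R, ¬ nule t 1 := by
    by_contra hc
    push Not at hc
    obtain ⟨y, -, hy⟩ := inv hR hg0
    have h2 := mulmono g (hc y)
    have h3 := trans' (le_of_nueq h hy.symm) h2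
    rw [mul_one] at h3
    have := antisymm' h3 (hc g)
    unfold nueq at this
    rw [gh h hg, mul_one] at this
    exact hg1 this.symm
  by_cases hx : x = 0
  · refine ⟨g, ?_⟩
    subst hx
    exact fun H => hg0 (eq_zero_of_le h H)
  · obtain ⟨t, ht⟩ := h1
    refine ⟨x*t, ?_⟩
    have := ltmul hR hx ht
    rwa [mul_one] at this

lemma zero_case (hR : IsNTSupersemifield R) {α₁ α₂ β : R}
    (H : ∀ a c : R, α₁*a^2 + α₂*c^2 + β*(a*c) = α₁*a^2 + α₂*c^2) (h1 : α₁ = 0) :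
    β = 0 := by
  by_contra hb
  subst h1
  have h := hR.1
  obtain ⟨s, hs⟩ := exists_gt hR α₂
  obtain ⟨i, hi, hi'⟩ := inv hR hb
  obtain ⟨g, hg, hg0, hg1⟩ := hR.2.2.2.2
  have h1 : (1:R) ≠ 0 := by
    intro h1; apply hg0; rw [← one_mul g, h1, zero_mul]
  refine viol hR H (a := i*s) (c := 1) (mul_ne hR (tang_ne hi) (ne_of_lt hs)) h1 ?_ ?_
  · rw [zero_mul, mul_one]; exact fun H => hb (eq_zero_of_le h H)
  · intro h2
    apply hs
    have := nueq_mul s hi'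
    rw [mul_one] at this h2
    refine trans' (le_of_nueq h this.symm) ?_
    rwa [show s*(β*i) = β*(i*s) by ring]

lemma zero_or (hR : IsNTSupersemifield R) {a b : R} (H : a*b = 0) : a = 0 ∨ b = 0 := by
  by_contra hc; push Not at hc; exact mul_ne hR hc.1 hc.2 H

lemma swapH {α₁ α₂ β : R}
    (H : ∀ a c : R, α₁*a^2 + α₂*c^2 + β*(a*c) = α₁*a^2 + α₂*c^2) :
    ∀ a c : R, α₂*a^2 + α₁*c^2 + β*(a*c) = α₂*a^2 + α₁*c^2 := by
  intro a c
  have := H c a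
  rwa [add_comm (α₁*_), mul_comm c a] at this

/-- If `γ` (any element) satisfies `α₁α₂ < βγ` and `γ < β`, contradiction. -/
lemma mid (hR : IsNTSupersemifield R) {α₁ α₂ β γ : R}
    (H : ∀ a c : R, α₁*a^2 + α₂*c^2 + β*(a*c) = α₁*a^2 + α₂*c^2)
    (h0 : α₁ ≠ 0) (h1 : ¬ nule (β*γ) (α₁*α₂)) (h2 : ¬ nule β γ) : False := by
  have hγ : γ ≠ 0 := by rintro rfl; exact ne_of_lt h1 (mul_zero _)
  refine viol hR H (a := γ) (c := α₁) hγ h0 ?_ ?_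
  · rw [mul_comm β]; exact ltmul hR h0 h2
  · rwa [mul_comm α₂]

end ST

/-- For `q = [α₁, α; α₂]` on `R² = Rε₁ ⊕ Rε₂` over a nontrivial tangible
supersemifield with `α² ≤_ν α₁α₂`, one has `C_{1,2}(q) = {β | β² ≤_ν α₁α₂}`, except when
`R` is discrete, `α₁α₂` is not a ν-square, and both `α₁, α₂` are ghost; in that exceptional
case `C_{1,2}(q) = {β | β² ≤_ν π⁻¹α₁α₂}` (i.e. `πβ² ≤_ν α₁α₂`) for a prime element `π`. -/
theorem stmt_16 {R : Type*} [CommSemiring R] (hR : IsNTSupersemifield R)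
    (α₁ α₂ α : R) (hle : nule (α ^ 2) (α₁ * α₂))
    (q : R × R → R)
    (hq : ∀ x : R × R, q x = α₁ * x.1 ^ 2 + α₂ * x.2 ^ 2 + α * (x.1 * x.2)) :
    ((¬ (DiscreteR R ∧ ¬ IsNuSquare (α₁ * α₂) ∧ α₁ ∈ ghost R ∧ α₂ ∈ ghost R)) →
      companionSet q ((1 : R), (0 : R)) ((0 : R), (1 : R)) =
        {β : R | nule (β ^ 2) (α₁ * α₂)}) ∧
    (∀ p : R, IsPrimeElem p → DiscreteR R → ¬ IsNuSquare (α₁ * α₂) →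
      α₁ ∈ ghost R → α₂ ∈ ghost R →
      companionSet q ((1 : R), (0 : R)) ((0 : R), (1 : R)) =
        {β : R | nule (p * β ^ 2) (α₁ * α₂)}) := by
  have h := hR.1
  have M := ST.mem_iff hR α₁ α₂ α hle q hq
  constructor
  · intro hex
    ext β
    rw [M]
    refine ⟨fun H => ?_, fun H => ST.le_mem hR H⟩
    show nule (β^2) (α₁*α₂)
    by_contra hc
    have hβ : β ≠ 0 := by rintro rfl; apply hc; simpa using ST.zero_le' _
    by_cases g1 : α₁ ∈ ghost R
    swap
    · exact hc (ST.tang hR H g1)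
    by_cases g2 : α₂ ∈ ghost R
    swap
    · exact hc (by have := ST.tang hR (ST.swapH H) g2; rwa [mul_comm] at this)
    by_cases z1 : α₁ = 0
    · exact hβ (ST.zero_case hR H z1)
    by_cases z2 : α₂ = 0
    · exact hβ (ST.zero_case hR (ST.swapH H) z2)
    by_cases sq : IsNuSquare (α₁*α₂)
    · obtain ⟨γ, hγ⟩ := sq
      have h2 : ¬ nule β γ := by
        intro h3
        apply hc
        have a1 := ST.mulmono β h3
        have a2 := ST.mulmono γ h3
        rw [mul_comm γ β] at a2
        have a3 := ST.trans' a1 a2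
        rw [← pow_two, ← pow_two] at a3
        exact ST.trans' a3 (ST.le_of_nueq h hγ.symm)
      refine ST.mid hR H z1 ?_ h2
      intro h3
      have h4 := ST.trans' h3 (ST.le_of_nueq h hγ)
      have hγ0 : γ ≠ 0 := by
        rintro rfl
        apply ST.mul_ne hR z1 z2
        apply ST.eq_zero h
        rw [hγ]; simp
      rw [pow_two, mul_comm β] at h4
      exact h2 (ST.cancel hR hγ0 h4)
    · have nd : ¬ DiscreteR R := fun hd => hex ⟨hd, sq, g1, g2⟩
      unfold DiscreteR at nd
      push Not at nd
      obtain ⟨x, hx, hx0, hnd⟩ := nd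
      -- translate
      have hb2 : β^2 ≠ 0 := by rw [pow_two]; exact ST.mul_ne hR hβ hβ
      obtain ⟨j, hj, hj'⟩ := ST.inv hR hb2
      have hu0 : x*(α₁*α₂*j) ≠ 0 :=
        ST.mul_ne hR hx0 (ST.mul_ne hR (ST.mul_ne hR z1 z2) (ST.tang_ne hj))
      have ug : x*(α₁*α₂*j) ∈ ghost R := by
        obtain ⟨r, hr⟩ := hx
        exact ⟨r*(α₁*α₂*j), by rw [← hr]; simp only [mul_assoc]⟩
      have ltu : ¬ nule x (x*(α₁*α₂*j)) := by
        have := ST.ltmul hR hx0 (ST.ltmul hR (ST.tang_ne hj) hc)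
        intro h3
        apply this
        have a1 := ST.nueq_mul x hj'
        rw [mul_one, mul_comm (β^2)] at a1
        rw [mul_comm j (α₁*α₂)]
        exact ST.trans' (ST.le_of_nueq h a1) h3
      have glt_iff : ∀ a ∈ ghost R, ∀ b ∈ ghost R, glt a b ↔ ¬ nule b a := by
        intro a ha b hb
        unfold glt nule
        rw [ST.gh h ha, ST.gh h hb]
        constructor
        · rintro ⟨h1, h2⟩ h3
          rw [add_comm, h1] at h3
          exact h2 h3.symm
        · intro h3
          have : ¬ nule b a := by unfold nule; rwa [ST.gh h ha, ST.gh h hb]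
          refine ⟨ST.add_lt h this, ?_⟩
          rintro rfl
          exact this (ST.le_rfl' h _)
      obtain ⟨y, hy, hy0, hyx, hyu⟩ := hnd _ ug hu0 ((glt_iff _ ug _ hx).2 ltu)
      have hyx' := (glt_iff _ hy _ hx).1 hyx
      have hyu' : ¬ nule y (x*(α₁*α₂*j)) := by
        intro h3; apply hyu; unfold nule at h3; unfold gle
        rwa [ST.gh h hy, ST.gh h ug] at h3
      obtain ⟨k, hk, hk'⟩ := ST.inv hR hx0
      refine ST.mid hR (γ := β*(y*k)) H z1 ?_ ?_
      · have a1 := ST.ltmul hR (ST.mul_ne hR hb2 (ST.tang_ne hk)) hyu'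
        intro h3
        apply a1
        have a2 := ST.nueq_mul (α₁*α₂*(β^2*j)) hk'
        have a3 := ST.nueq_mul (α₁*α₂) hj'
        rw [mul_one] at a2 a3
        have a4 := ST.trans' h3 (ST.le_of_nueq h (a2.trans a3).symm)
        convert a4 using 1 <;> ring
      · have a1 := ST.ltmul hR (ST.mul_ne hR hβ (ST.tang_ne hk)) hyx'
        intro h3
        apply a1
        have a2 := ST.nueq_mul β hk'
        rw [mul_one] at a2
        have a4 := ST.trans' (ST.le_of_nueq h a2) h3
        convert a4 using 1 <;> ring
  · intro p hp hd sq g1 g2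
    have z1 : α₁ ≠ 0 := by
      rintro rfl; exact sq ⟨0, by simp⟩
    obtain ⟨hpt, hplt, hpmax⟩ := hp
    have hp0 := ST.tang_ne hpt
    have p1 : ¬ nule 1 p := by
      intro h3
      unfold nule at h3
      rw [mul_one, add_comm, hplt.1] at h3
      exact hplt.2 h3.symm
    ext β
    rw [M]
    constructor
    · intro H
      show nule (p*β^2) (α₁*α₂)
      by_contra hc
      have hβ : β ≠ 0 := by rintro rfl; apply hc; simpa using ST.zero_le' _
      refine ST.mid hR (γ := β*p) H z1 ?_ ?_
      · rwa [show β*(β*p) = p*β^2 by ring]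
      · have := ST.ltmul hR hβ p1
        rwa [mul_one] at this
    · intro H a c
      have H : nule (p*β^2) (α₁*α₂) := H
      have sg : α₁*a^2 + α₂*c^2 ∈ ghost R := by
        obtain ⟨r, rfl⟩ := g1
        obtain ⟨s, rfl⟩ := g2
        exact ⟨r*a^2 + s*c^2, by simp only; ring⟩
      apply ST.add_ghost h _ sg
      -- key: not both strictly smaller
      have key : nule (β*(a*c)) (α₁*a^2) ∨ nule (β*(a*c)) (α₂*c^2) := by
        by_contra hcon
        push Not at hcon
        obtain ⟨k1, k2⟩ := hcon
        have n1 := ST.ne_of_lt k1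
        have hac : a*c ≠ 0 := by intro h3; rw [h3, mul_zero] at n1; exact n1 rfl
        have below : ∀ u v : R, v ≠ 0 → ¬ nule v u → nule u (p*v) := by
          intro u v hv huv
          obtain ⟨k, hk, hk'⟩ := ST.inv hR hv
          by_cases hu : u = 0
          · rw [hu]; exact ST.zero_le' _
          have w0 : ((1:R)+1)*(u*k) ≠ 0 := fun h3 =>
            ST.mul_ne hR hu (ST.tang_ne hk) (ST.eq_zero h h3)
          have w1 : ¬ nule 1 (u*k) := by
            have := ST.ltmul hR (ST.tang_ne hk) huv
            intro h3; apply this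
            rw [mul_comm k v, mul_comm k u]
            exact ST.trans' (ST.le_of_nueq h hk') h3
          have w2 : nule (u*k) 1 := (ST.total h _ _).resolve_right w1
          have w3 := hpmax _ ⟨u*k, rfl⟩ w0 ⟨by
            unfold nule at w2; rwa [mul_one] at w2, fun h3 => w1 (ST.le_of_nueq h (by
              unfold nueq; rw [mul_one]; exact h3.symm))⟩
          have w4 : nule (u*k) p := w3
          have w5 := ST.mulmono v w4
          have w6 := ST.nueq_mul u hk'
          rw [mul_one] at w6
          rw [mul_comm p v]
          refine ST.trans' (ST.le_of_nueq h w6.symm) ?_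
          convert w5 using 1; ring
        have b1 := below _ _ n1 k1
        have b2 := ST.mulmono (α₂*c^2) b1
        have b3 := ST.ltmul hR (ST.mul_ne hR hp0 n1) k2
        apply b3
        have b4 := ST.mulmono ((a*c)^2) H
        refine ST.trans' (b := (a*c)^2*(α₁*α₂)) ?_ ?_
        · convert b4 using 1; ring
        · convert b2 using 1 <;> ring
      have lea : ∀ x y : R, nule x (x+y) := by
        intro x y
        have : ∀ w : R, ((1:R)+1)*w + ((1:R)+1)*w = ((1:R)+1)*w := fun w => by
          rw [← add_mul, h.1]
        unfold nule
        rw [mul_add, ← add_assoc, this]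
      rcases key with k | k
      · exact ST.trans' k (lea _ _)
      · refine ST.trans' k ?_
        rw [add_comm]; exact lea _ _
end

section
/- Let R be an upper bound commutative semiring satisfying: (i) a + a = 0 implies a = 0 for all a ∈ R, and (ii) (a+b)^2 = a^2 + b^2 for all a, b ∈ R. Let V be a free R-module with basis (ε_i)_{i∈I} and q a quadratic form on V, and set q_QL(x) := Σ_i q(ε_i)·x_i² for x = Σ_i x_iε_i. Then q_QL is quasilinear, q_QL(x) ≤ q(x) for all x ∈ V, and every quasilinear quadratic form χ on V with χ(x) ≤ q(x) for all x ∈ V satisfies χ(x) ≤ q_QL(x) for all x ∈ V; i.e., q_QL is the unique maximal quasilinear form below q in the pointwise minimal ordering. -/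
/-- Over an upper bound semiring satisfying (i) and (ii), the quasilinear
part `q_QL(x) = Σ_i q(ε_i)·x_i²` is the unique maximal quasilinear form below `q` in the
pointwise minimal ordering. -/
theorem stmt_17 {R V ι : Type*} [CommSemiring R] [AddCommMonoid V] [Module R V]
    (hub : IsUB R)
    (h1 : ∀ a : R, a + a = 0 → a = 0)
    (h2 : ∀ a b : R, (a + b) ^ 2 = a ^ 2 + b ^ 2)
    (ε : Module.Basis ι R V) (q : V → R) (hq : IsQuadForm q)
    (qQL : V → R) (hqQL : ∀ x, qQL x = (ε.repr x).sum fun i c => q (ε i) * c ^ 2) :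
    IsQuasilinear qQL ∧ (∀ x, mle (qQL x) (q x)) ∧
      ∀ χ : V → R, IsQuasilinear χ → (∀ x, mle (χ x) (q x)) →
        ∀ x, mle (χ x) (qQL x) := by
  have hadd : ∀ x y, qQL (x + y) = qQL x + qQL y := by
    intro x y
    rw [hqQL, hqQL, hqQL, map_add]
    apply Finsupp.sum_add_index'
    · intro i; simp
    · intro i a c; rw [h2, mul_add]
  have hsing : ∀ i a, qQL (a • ε i) = a ^ 2 * q (ε i) := by
    intro i a
    rw [hqQL, map_smul, ε.repr_self, Finsupp.smul_single, smul_eq_mul, mul_one,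
      Finsupp.sum_single_index (by simp), mul_comm]
  have h0 : qQL 0 = 0 := by rw [hqQL]; simp
  have ind : ∀ P : V → Prop, P 0 → (∀ x y, P x → P y → P (x + y)) →
      (∀ (a : R) i, P (a • ε i)) → ∀ x, P x := by
    intro P p0 pa ps x
    have key : ∀ f : ι →₀ R, P (ε.repr.symm f) := by
      intro f
      induction f using Finsupp.induction_linear with
      | zero => simpa using p0
      | add f g hf hg => rw [map_add]; exact pa _ _ hf hg
      | single i a => rw [ε.repr_symm_single]; exact ps a i
    simpa using key (ε.repr x)
  have hsmul : ∀ (a : R) x, qQL (a • x) = a ^ 2 * qQL x := by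
    intro a
    apply ind
    · simp [h0]
    · intro x y hx hy
      rw [smul_add, hadd, hadd, hx, hy, mul_add]
    · intro c i
      rw [smul_smul, hsing, hsing, mul_pow, mul_assoc]
  obtain ⟨hqs, b, -, hb⟩ := hq
  refine ⟨⟨⟨hsmul, fun _ _ => 0, ⟨by simp, by simp, by simp⟩, ?_⟩, hadd⟩, ?_, ?_⟩
  · intro x y
    simp [Accomp, hadd]
  · apply ind
    · exact ⟨q 0, by rw [h0, zero_add]⟩
    · rintro x y ⟨u, hu⟩ ⟨v, hv⟩
      refine ⟨u + v + b x y, ?_⟩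
      rw [hadd, hb x y, ← hu, ← hv]
      ac_rfl
    · intro a i
      exact ⟨0, by rw [hsing, hqs, add_zero]⟩
  · rintro χ ⟨⟨hs, -⟩, ha⟩ hle
    apply ind
    · refine ⟨0, ?_⟩
      have := hs 0 0
      simp at this
      rw [this, h0, add_zero]
    · rintro x y ⟨u, hu⟩ ⟨v, hv⟩
      refine ⟨u + v, ?_⟩
      rw [hadd, ha, ← hu, ← hv]
      ac_rfl
    · intro a i
      rw [hsing, ← hqs]
      exact hle _
end

section
/- Let R be an upper bound commutative semiring satisfying: (i) a + a = 0 implies a = 0 for all a ∈ R, and (ii) (a+b)^2 = a^2 + b^2 for all a, b ∈ R. Let V be a free R-module with basis (ε_i)_{i∈I}, and order quadratic forms on V pointwise by the minimal ordering of R. Then: (a) if ρ is a rigid quadratic form on V and χ is a quadratic form on V with χ ≤ ρ, then χ is rigid; (b) for any quadratic form q on V, the set Rig(q) is convex: if ρ₁, ρ₂ ∈ Rig(q) and χ is a quadratic form with ρ₁ ≤ χ ≤ ρ₂, then χ ∈ Rig(q); (c) if q is quasilinear, then Rig(q) is a lower set (ρ ∈ Rig(q) and χ ≤ ρ imply χ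 ∈ Rig(q)) and is closed under addition (ρ₁, ρ₂ ∈ Rig(q) imply ρ₁ + ρ₂ ∈ Rig(q)). -/
section Helpers

variable {R V ι : Type*} [CommSemiring R] [AddCommMonoid V] [Module R V]

theorem aux_ind (ε : Module.Basis ι R V) {P : V → Prop} (x : V) (h0 : P 0)
    (hε : ∀ i, P (ε i)) (ha : ∀ x y, P x → P y → P (x + y))
    (hs : ∀ (a : R) x, P x → P (a • x)) : P x := by
  refine Submodule.span_induction (p := fun x _ => P x) ?_ h0
    (fun x y _ _ hx hy => ha x y hx hy) (fun a x _ hx => hs a x hx) (ε.mem_span x)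
  rintro _ ⟨i, rfl⟩
  exact hε i

theorem aux_zero {q : V → R} (h : IsQuadForm q) : q 0 = 0 := by
  have := h.1 0 0
  simpa using this

theorem aux_ql_ext (ε : Module.Basis ι R V) {c d : V → R} (hc : IsQuasilinear c)
    (hd : IsQuasilinear d) (h : ∀ i, c (ε i) = d (ε i)) : ∀ x, c x = d x := by
  intro x
  refine aux_ind ε (P := fun x => c x = d x) x ?_ h ?_ ?_
  · rw [aux_zero hc.1, aux_zero hd.1]
  · intro x y hx hy; rw [hc.2, hd.2, hx, hy]
  · intro a x hx; rw [hc.1.1, hd.1.1, hx]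

theorem aux_rigid (ε : Module.Basis ι R V) {q : V → R} (hq : IsQuadForm q)
    (h : ∀ i, q (ε i) = 0) : IsRigid q := by
  refine ⟨hq, fun b c hb hc => ?_⟩
  have key : ∀ i j, b (ε i) (ε j) = c (ε i) (ε j) := by
    intro i j
    have e1 := hb.2 (ε i) (ε j)
    have e2 := hc.2 (ε i) (ε j)
    simp only [Accomp, h, zero_add] at e1 e2
    rw [← e1, ← e2]
  have z : ∀ {b : V → V → R}, SymmBilin b → ∀ y, b 0 y = 0 := by
    intro b hb y
    have := hb.2.1 0 0 y
    simpa using this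
  obtain ⟨⟨sb, mb, ab⟩, -⟩ := id hb
  obtain ⟨⟨sc, mc, ac⟩, -⟩ := id hc
  funext x y
  refine aux_ind ε (P := fun x => b x y = c x y) x ?_ ?_ ?_ ?_
  · rw [z hb.1, z hc.1]
  · intro i
    rw [sb, sc]
    refine aux_ind ε (P := fun y => b y (ε i) = c y (ε i)) y ?_ ?_ ?_ ?_
    · rw [z hb.1, z hc.1]
    · intro j; exact key j i
    · intro x y hx hy; rw [ab, ac, hx, hy]
    · intro a x hx; rw [mb, mc, hx]
  · intro x y hx hy; rw [ab, ac, hx, hy]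
  · intro a x hx; rw [mb, mc, hx]

theorem aux_rigid_zero (h1 : ∀ a : R, a + a = 0 → a = 0)
    (h2 : ∀ a b : R, (a + b) ^ 2 = a ^ 2 + b ^ 2) (ε : Module.Basis ι R V) {q : V → R}
    (hq : IsRigid q) (i : ι) : q (ε i) = 0 := by
  classical
  obtain ⟨⟨hom, b, ⟨sb, mb, ab⟩, cb⟩, huniq⟩ := hq
  simp only [Accomp] at cb
  obtain ⟨p, hp⟩ : ∃ p : V → V, p = fun x => ε.repr.symm ((ε.repr x).erase i) := ⟨_, rfl⟩
  obtain ⟨f, hf⟩ : ∃ f : V → R, f = fun x => ε.repr x i := ⟨_, rfl⟩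
  have pa : ∀ x y, p (x + y) = p x + p y := by
    intro x y; simp [hp, Finsupp.erase_add]
  have ps : ∀ (a : R) x, p (a • x) = a • p x := by
    intro a x
    apply ε.repr.injective
    ext j
    simp only [hp, map_smul, LinearEquiv.apply_symm_apply]
    by_cases hj : j = i
    · simp [hj]
    · simp [Finsupp.erase_ne hj]
  have fa : ∀ x y, f (x + y) = f x + f y := by intro x y; simp [hf]
  have fs : ∀ (a : R) x, f (a • x) = a * f x := by intro a x; simp [hf]
  have pe : p (ε i) = 0 := by simp [hp]
  have fe : f (ε i) = 1 := by simp [hf]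
  have dec : ∀ x, f x • ε i + p x = x := by
    intro x
    apply ε.repr.injective
    simp [hf, hp, Finsupp.single_add_erase]
  have br : ∀ x y z, b x (y + z) = b x y + b x z := by
    intro x y z; rw [sb, ab, sb y, sb z]
  have bm : ∀ (a : R) x y, b x (a • y) = a * b x y := by
    intro a x y; rw [sb, mb, sb y]
  have bz : ∀ x, b x 0 = 0 := by
    intro x
    have := bm 0 x 0
    simpa using this
  have qd : ∀ x, q x = f x ^ 2 * q (ε i) + q (p x) + f x * b (ε i) (p x) := by
    intro x
    conv_lhs => rw [← dec x]
    rw [cb, hom, mb]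
  have comp : ∀ t : R, (∀ u v : R, (u + v) ^ 2 * q (ε i) =
      (u ^ 2 + v ^ 2) * q (ε i) + t * u * v) → IsCompanion q
      (fun x y => b (p x) (p y) + f x * b (ε i) (p y) + f y * b (ε i) (p x) + t * f x * f y) := by
    intro t ht
    refine ⟨⟨?_, ?_, ?_⟩, ?_⟩
    · intro x y
      simp only
      rw [sb (p x)]; ring
    · intro a x y
      simp only [ps, fs, mb, bm]; ring
    · intro x x' y
      simp only [pa, fa, ab, br]; ring
    · intro x y
      simp only [Accomp]
      rw [qd (x + y), qd x, qd y, fa, ht, pa, cb, br]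
      ring
  have c0 := comp 0 (by intro u v; rw [h2]; ring)
  have c1 := comp (q (ε i) + q (ε i)) (by
    intro u v
    ring)
  have := congrFun (congrFun (huniq _ _ c0 c1) (ε i)) (ε i)
  simp only [pe, fe, bz] at this
  apply h1
  simpa using this.symm

end Helpers



/-- Over an upper bound semiring satisfying (i) and (ii), with quadratic
forms ordered pointwise by the minimal ordering: (a) rigid forms are a lower set;
(b) `Rig(q)` is convex for every quadratic form `q`; (c) if `q` is quasilinear then
`Rig(q)` is a lower set closed under addition. -/
theorem stmt_18 {R V ι : Type*} [CommSemiring R] [AddCommMonoid V] [Module R V]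
    (hub : IsUB R)
    (h1 : ∀ a : R, a + a = 0 → a = 0)
    (h2 : ∀ a b : R, (a + b) ^ 2 = a ^ 2 + b ^ 2)
    (ε : Module.Basis ι R V) :
    (∀ ρ χ : V → R, IsRigid ρ → IsQuadForm χ → (∀ x, mle (χ x) (ρ x)) → IsRigid χ) ∧
    (∀ q ρ₁ ρ₂ χ : V → R, IsQuadForm q → ρ₁ ∈ RigSet q → ρ₂ ∈ RigSet q →
        IsQuadForm χ → (∀ x, mle (ρ₁ x) (χ x)) → (∀ x, mle (χ x) (ρ₂ x)) →
        χ ∈ RigSet q) ∧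
    (∀ q : V → R, IsQuasilinear q →
      (∀ ρ χ : V → R, ρ ∈ RigSet q → IsQuadForm χ → (∀ x, mle (χ x) (ρ x)) →
          χ ∈ RigSet q) ∧
      (∀ ρ₁ ρ₂ : V → R, ρ₁ ∈ RigSet q → ρ₂ ∈ RigSet q →
          (fun x => ρ₁ x + ρ₂ x) ∈ RigSet q)) := by
  have A : ∀ ρ χ : V → R, IsRigid ρ → IsQuadForm χ → (∀ x, mle (χ x) (ρ x)) → IsRigid χ := by
    intro ρ χ hρ hχ hle
    refine aux_rigid ε hχ fun i => ?_
    have h := hle (ε i)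
    rw [aux_rigid_zero h1 h2 ε hρ i] at h
    exact hub _ _ h ⟨χ (ε i), zero_add _⟩
  have Z : ∀ ρ : V → R, IsRigid ρ → ∀ i, ρ (ε i) = 0 :=
    fun ρ hρ i => aux_rigid_zero h1 h2 ε hρ i
  have S : ∀ q ρ : V → R, IsQuasilinear q → ρ ∈ RigSet q → ∀ x, q x = q x + ρ x := by
    rintro q ρ hq ⟨hρ, c, hc, e⟩ x
    have : ∀ x, c x = q x := aux_ql_ext ε hc hq fun i => by rw [e, Z ρ hρ, add_zero]
    rw [← this x, ← e x, this x]
  refine ⟨A, ?_, ?_⟩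
  · rintro q ρ₁ ρ₂ χ hq ⟨hρ₁, c, hc, e⟩ ⟨hρ₂, d, hd, e'⟩ hχ l1 l2
    refine ⟨A _ _ hρ₂ hχ l2, c, hc, fun x => ?_⟩
    have hcd : ∀ x, c x = d x := aux_ql_ext ε hc hd fun i => by
      have u := e (ε i)
      have v := e' (ε i)
      rw [Z _ hρ₁, add_zero] at u
      rw [Z _ hρ₂, add_zero] at v
      rw [← u, ← v]
    obtain ⟨s, hs⟩ := l1 x
    obtain ⟨t, ht⟩ := l2 x
    refine hub _ _ ⟨s, ?_⟩ ⟨t, ?_⟩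
    · rw [e, add_assoc, hs]
    · rw [e', add_assoc, ht, hcd]
  · intro q hq
    refine ⟨?_, ?_⟩
    · intro ρ χ hρ hχ hle
      refine ⟨A _ _ hρ.1 hχ hle, q, hq, fun x => ?_⟩
      obtain ⟨t, ht⟩ := hle x
      refine hub _ _ ⟨χ x, rfl⟩ ⟨t, ?_⟩
      rw [add_assoc, ht, ← S q ρ hq hρ]
    · intro ρ₁ ρ₂ k1 k2
      refine ⟨aux_rigid ε ?_ ?_, q, hq, fun x => ?_⟩
      · obtain ⟨m1, b, ⟨s1, t1, u1⟩, c1⟩ := k1.1.1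
        obtain ⟨m2, c, ⟨s2, t2, u2⟩, c2⟩ := k2.1.1
        simp only [Accomp] at c1 c2
        refine ⟨?_, fun x y => b x y + c x y, ⟨?_, ?_, ?_⟩, ?_⟩
        · intro a x
          simp only [m1, m2]; ring
        · intro x y
          simp only
          rw [s1, s2]
        · intro a x y
          simp only [t1, t2]; ring
        · intro x x' y
          simp only [u1, u2]; ring
        · intro x y
          simp only [Accomp, c1, c2]; ring
      · intro i
        simp only [Z _ k1.1, Z _ k2.1, add_zero]
      · rw [← add_assoc, ← S q ρ₁ hq k1, ← S q ρ₂ hq k2]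
end
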